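/- arXiv:2411.10207 — 3 statements merged into one kernel-verified Lean document; each statement's English description precedes it below -/
import Mathlib

section
/- Up to the action of the isometries of the square lattice (translations, rotations by multiples of 90°, and reflections), there are exactly 21 tetromino fences whose enclosed area is 9, the maximal value. -/
/-- Cells of the square lattice. -/
abbrev Cell : Type := ℤ × ℤ

/-- Two cells are adjacent if they differ by (±1,0) or (0,±1). -/
def Adj (p q : Cell) : Prop := (p.1 - q.1).natAbs + (p.2 - q.2).natAbs = 1

/-- `q` is reachable from `p` by a path of adjacent cells inside `S`. -/
def ReachIn (S : Set Cell) (p q : Cell) : Prop :=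
  Relation.ReflTransGen (fun x y => Adj x y ∧ x ∈ S ∧ y ∈ S) p q

/-- A set of cells is connected if any two of its cells are joined by a path
of adjacent cells inside the set. -/
def SetConnected (S : Set Cell) : Prop := ∀ p ∈ S, ∀ q ∈ S, ReachIn S p q

/-- The connected component of `c` in `S` under adjacency. -/
def component (S : Set Cell) (c : Cell) : Set Cell := {d | ReachIn S c d}

/-- A cell `c ∉ F` is enclosed by `F` if its connected component in the
complement of `F` is finite. -/
def Enclosed (F : Set Cell) (c : Cell) : Prop := c ∉ F ∧ (component Fᶜ c).Finite

/-- The enclosed area of `F` is the number of cells enclosed by `F`. -/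
noncomputable def encArea (F : Set Cell) : ℕ := Set.ncard {c | Enclosed F c}

/-- The eight symmetries of the square lattice (rotations by multiples of 90°
and reflections). -/
def symms : List (Cell → Cell) :=
  [fun p => (p.1, p.2), fun p => (-p.2, p.1), fun p => (-p.1, -p.2), fun p => (p.2, -p.1),
   fun p => (p.1, -p.2), fun p => (-p.1, p.2), fun p => (p.2, p.1), fun p => (-p.2, -p.1)]

/-- `Q` is a placement of the polyomino `P`: the image of `P` under a composition
of one of the eight symmetries of the square lattice with a translation. -/
def IsPlacement (P Q : Set Cell) : Prop :=
  ∃ f ∈ symms, ∃ t : Cell, Q = (fun c => f c + t) '' P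

/-- Two pieces are edge-adjacent if some cell of one is adjacent to a cell of the other. -/
def PieceAdj (A B : Set Cell) : Prop := ∃ a ∈ A, ∃ b ∈ B, Adj a b

/-- The five free tetrominoes I, L, N, O, T. -/
def tets : Fin 5 → Set Cell :=
  ![{(0,0), (0,1), (0,2), (0,3)},
    {(0,0), (1,0), (0,1), (0,2)},
    {(0,0), (1,0), (1,1), (2,1)},
    {(0,0), (1,0), (0,1), (1,1)},
    {(0,0), (1,0), (2,0), (1,1)}]

/-- A tetromino fence: five pairwise disjoint placements, one of each free
tetromino, whose union is connected, each piece being edge-adjacent to at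
least two of the other pieces. -/
structure TetFence where
  piece : Fin 5 → Set Cell
  placement : ∀ i, IsPlacement (tets i) (piece i)
  disj : Pairwise fun i j => Disjoint (piece i) (piece j)
  conn : SetConnected (⋃ i, piece i)
  adj2 : ∀ i, 2 ≤ Set.ncard {j | j ≠ i ∧ PieceAdj (piece i) (piece j)}

/-- The enclosed area of a tetromino fence. -/
noncomputable def TetFence.area (F : TetFence) : ℕ := encArea (⋃ i, F.piece i)

/-- Two tetromino fences are equivalent if one is carried to the other by an
isometry of ℤ² generated by translations, rotations by multiples of 90°, and
reflections. -/
def TetFenceEquiv (F G : TetFence) : Prop :=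
  ∃ f ∈ symms, ∃ t : Cell, ∀ i, G.piece i = (fun c => f c + t) '' F.piece i

set_option maxRecDepth 100000

namespace TFS

/-- An orientation: offsets of the three non-anchor cells. -/
structure O where
  k1 : ℕ
  k2 : ℕ
  k3 : ℕ

/-- Requirement on a pair of pieces: disjoint, adjacent or non-adjacent. -/
inductive R where
  | d
  | a
  | n

noncomputable def force (s m : ℕ) (k : ℕ → Bool) : Bool :=
  Nat.rec (motive := fun _ => Bool) (k 0) (fun n _ => k ((fun _ => Nat.succ n) s)) m

noncomputable def forceS (m : ℕ) (k : ℕ → Bool) : Bool :=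
  Nat.rec (motive := fun _ => Bool) (k 0) (fun n _ => k (Nat.succ n)) m

noncomputable def ifz (s m : ℕ) (a : Bool) (k : ℕ → Bool) : Bool :=
  Nat.rec (motive := fun _ => Bool) a (fun n _ => k ((fun _ => Nat.succ n) s)) m

noncomputable def andb (a b : Bool) : Bool := Bool.rec (motive := fun _ => Bool) false b a

noncomputable def forBits (s : ℕ) (k : ℕ → Bool) (fuel : ℕ) : ℕ → Bool :=
  Nat.rec (motive := fun _ => ℕ → Bool) (fun _ => false) (fun _ ih m =>
    Nat.rec (motive := fun _ => Bool) true (fun m' _ =>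
      force s (Nat.land ((fun _ => Nat.succ m') s) m') fun r =>
        andb (k (Nat.sub ((fun _ => Nat.succ m') s) r)) (ih r)) m) fuel

noncomputable def diffN (a b : ℕ) : ℕ := Nat.xor a (Nat.land a b)

noncomputable def halo (m : ℕ) : ℕ :=
  Nat.lor (Nat.lor (Nat.shiftLeft m 1) (Nat.shiftRight m 1))
    (Nat.lor (Nat.shiftLeft m 42) (Nat.shiftRight m 42))

noncomputable def hits (o : O) (h : ℕ) : ℕ :=
  Nat.lor (Nat.lor h (Nat.shiftRight h o.k1))
    (Nat.lor (Nat.shiftRight h o.k2) (Nat.shiftRight h o.k3))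

noncomputable def spread (o : O) (h : ℕ) : ℕ :=
  Nat.lor (Nat.lor h (Nat.shiftLeft h o.k1))
    (Nat.lor (Nat.shiftLeft h o.k2) (Nat.shiftLeft h o.k3))

noncomputable def tabV (q o : O) : ℕ := hits o (spread q (2 ^ 200))
noncomputable def tabH (q o : O) : ℕ := hits o (halo (spread q (2 ^ 200)))
noncomputable def tabA (q o : O) : ℕ := diffN (tabH q o) (tabV q o)
noncomputable def tabN (q o : O) : ℕ := Nat.lor (tabH q o) (tabV q o)

/-- A piece still to be placed: its type, its requirements relative to the next
placed pieces, and the possible orientations with bit masks of anchors. -/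
structure Slot where
  ty : ℕ
  req : List R
  dom : List (O × ℕ)

noncomputable def updOne (r : R) (q o : O) (b D : ℕ) : ℕ :=
  R.rec (motive := fun _ => ℕ) (diffN D (Nat.mul (tabV q o) b))
    (Nat.land D (Nat.mul (tabA q o) b)) (diffN D (Nat.mul (tabN q o) b)) r

noncomputable def updDom (s : ℕ) (r : R) (q : O) (b : ℕ) (l : List (O × ℕ)) :
    (List (O × ℕ) → Bool) → Bool :=
  List.rec (motive := fun _ => (List (O × ℕ) → Bool) → Bool) (fun k => k [])
    (fun x _ ih k => Prod.rec (motive := fun _ => Bool) (fun o D =>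
      ifz s (updOne r q o b D) (ih k) fun D => ih fun l' => k ((o, D) :: l')) x) l

noncomputable def updSlots (s : ℕ) (q : O) (b : ℕ) (l : List Slot) :
    (List Slot → Bool) → Bool :=
  List.rec (motive := fun _ => (List Slot → Bool) → Bool) (fun k => k [])
    (fun x _ ih k => Slot.rec (motive := fun _ => Bool) (fun ty req dom =>
      List.rec (motive := fun _ => Bool) false (fun r req' _ =>
      updDom s r q b dom fun d =>
        List.rec (motive := fun _ => Bool) true
          (fun _ _ _ => ih fun l' => k (⟨ty, req', d⟩ :: l')) d) req) x) l

noncomputable def allDom (l : List (O × ℕ)) (k : O → ℕ → Bool) : Bool :=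
  List.rec (motive := fun _ => Bool) true (fun x _ ih =>
    Prod.rec (motive := fun _ => Bool) (fun o D => andb (k o D) ih) x) l

noncomputable def unionDom (l : List (O × ℕ)) : ℕ :=
  List.rec (motive := fun _ => ℕ) 0 (fun x _ ih =>
    Prod.rec (motive := fun _ => ℕ) (fun o D => Nat.lor (spread o D) ih) x) l

/-- Cells which the next placed piece has to meet, if there is such a constraint. -/
noncomputable def filt (l : List Slot) : ℕ :=
  List.rec (motive := fun _ => ℕ) (2 ^ 1100 - 1)
    (fun x _ ih => Slot.rec (motive := fun _ => ℕ) (fun _ req dom =>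
      List.rec (motive := fun _ => ℕ) ih (fun r _ _ =>
        R.rec (motive := fun _ => ℕ) ih (halo (unionDom dom)) ih r) req) x) l

noncomputable def popLe (s : ℕ) (fuel : ℕ) : ℕ → Bool :=
  Nat.rec (motive := fun _ => ℕ → Bool) (fun m => Nat.beq m 0) (fun _ ih m =>
    Nat.rec (motive := fun _ => Bool) true (fun m' _ =>
      ih (Nat.land ((fun _ => Nat.succ m') s) m')) m) fuel

/-- Four lanes of width 2600: bits reached going right, left, up, down. -/
noncomputable def sm0 : ℕ :=
  Nat.rec (motive := fun _ => ℕ) 0 (fun j ih =>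
    Nat.lor ih (Nat.lor (Nat.lor (2 ^ (840 + j)) (2 ^ (3440 - j)))
      (Nat.lor (2 ^ (6040 + 42 * j)) (2 ^ (8640 - 42 * j))))) 21

noncomputable def smO (o : O) : ℕ := spread o sm0
noncomputable def maskO (o : O) : ℕ := spread o (2 ^ 840)

noncomputable def knownChk (known : List (List ℕ)) (placed : List (ℕ × ℕ)) : Bool :=
  known.any fun K => placed.all fun x => Nat.beq (K.getD x.1 0) x.2

noncomputable def leaf (known : List (List ℕ)) (s Z S : ℕ) (placed : List (ℕ × ℕ)) : Bool :=
  force s (Nat.land Z (Nat.shiftRight Z 2600)) fun Y =>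
  force s (diffN (Nat.land Y (Nat.shiftRight Y 5200)) S) fun E =>
  Bool.rec (motive := fun _ => Bool)
    (andb (popLe s 9 E) (knownChk known placed)) true (popLe s 8 E)

noncomputable def search (known : List (List ℕ)) (fuel : ℕ) :
    ℕ → ℕ → ℕ → List (ℕ × ℕ) → List Slot → Bool :=
  Nat.rec (motive := fun _ => ℕ → ℕ → ℕ → List (ℕ × ℕ) → List Slot → Bool)
    (fun s Z S pl _ => leaf known s Z S pl)
    (fun _ ih s Z S pl slots =>
      List.rec (motive := fun _ => Bool) false
        (fun x rest _ => Slot.rec (motive := fun _ => Bool) (fun ty _ dom =>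
          force s (filt rest) fun F =>
          allDom dom fun o D => forBits s (fun c =>
          force s (Nat.shiftRight c 200) fun b =>
          forceS (Nat.mod (Nat.add (Nat.mul s 33) b) 2147483629) fun s =>
          updSlots s o b rest fun rest' =>
          force s (Nat.lor Z (Nat.mul (smO o) b)) fun Z =>
          force s (Nat.lor S (Nat.mul (maskO o) b)) fun S =>
          ih s Z S ((ty, Nat.mul (maskO o) b) :: pl) rest') 300
            (Nat.land D (hits o F))) x) slots) fuel

def oriL : List O := [⟨1, 42, 84⟩]
def ori0 : List O := [⟨42, 84, 126⟩, ⟨1, 2, 3⟩]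
def ori2 : List O := [⟨1, 43, 44⟩, ⟨41, 42, 83⟩, ⟨1, 41, 42⟩, ⟨42, 43, 85⟩]
def ori3 : List O := [⟨1, 42, 43⟩]
def ori4 : List O := [⟨1, 2, 43⟩, ⟨41, 42, 84⟩, ⟨41, 42, 43⟩, ⟨42, 43, 84⟩]

/-- Orientations of the piece of each type. -/
def ori (t : ℕ) : List O := match t with
  | 0 => ori0 | 1 => oriL | 2 => ori2 | 3 => ori3 | _ => ori4

noncomputable def mkSlots (pl : List (ℕ × List R)) : List Slot :=
  pl.map fun x => ⟨x.1, x.2, (ori x.1).map fun o => (o, 2 ^ 1100 - 1)⟩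
noncomputable def run (known : List (List ℕ)) (pl : List (ℕ × List R)) : Bool :=
  search known 5 7 0 0 [] (⟨1, [], [(⟨1, 42, 84⟩, 2 ^ 630)]⟩ :: mkSlots pl)

/-! ### Soundness of the search -/

theorem force_eq (s m : ℕ) (k : ℕ → Bool) : force s m k = k m := by
  cases m <;> rfl

theorem forceS_eq (m : ℕ) (k : ℕ → Bool) : forceS m k = k m := by
  cases m <;> rfl

theorem ifz_eq (s m : ℕ) (a : Bool) (k : ℕ → Bool) :
    ifz s m a k = if m = 0 then a else k m := by
  cases m <;> simp [ifz]

theorem andb_eq (a b : Bool) : andb a b = (a && b) := by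
  cases a <;> rfl

theorem land_pred {m : ℕ} (hm : m ≠ 0) :
    ∃ q, m.testBit q = true ∧ m - Nat.land m (m - 1) = 2 ^ q ∧
      ∀ i, (Nat.land m (m - 1)).testBit i = (m.testBit i && decide (i ≠ q)) := by
  obtain ⟨q, n, hn, rfl⟩ := Nat.exists_eq_two_pow_mul_odd hm
  obtain ⟨j, rfl⟩ := hn
  have hpos : 0 < 2 ^ q := Nat.two_pow_pos q
  have h1 : 2 ^ q * (2 * j + 1) = 2 ^ q * (2 * j + 1) + 0 := rfl
  have h2 : 2 ^ q * (2 * j + 1) - 1 = 2 ^ q * (2 * j) + (2 ^ q - 1) := by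
    rw [Nat.mul_add, Nat.mul_one]; omega
  have key : Nat.land (2 ^ q * (2 * j + 1)) (2 ^ q * (2 * j + 1) - 1)
      = 2 ^ q * (2 * j) := by
    apply Nat.eq_of_testBit_eq
    intro i
    have e : (Nat.land (2 ^ q * (2 * j + 1)) (2 ^ q * (2 * j + 1) - 1)).testBit i
      = ((2 ^ q * (2 * j + 1)).testBit i && (2 ^ q * (2 * j + 1) - 1).testBit i) :=
      Nat.testBit_land _ _ _
    rw [e, h2, Nat.testBit_two_pow_mul_add _ (by omega), Nat.testBit_two_pow_mul,
      Nat.testBit_two_pow_mul]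
    by_cases hi : i < q
    · have : ¬ q ≤ i := by omega
      simp [this]
    · have hqi : q ≤ i := by omega
      simp only [hi, if_false, hqi, decide_true, Bool.true_and]
      rcases Nat.eq_zero_or_pos (i - q) with h0 | h0
      · rw [h0]; simp
      · obtain ⟨d, hd⟩ : ∃ d, i - q = d + 1 := ⟨i - q - 1, by omega⟩
        rw [hd, Nat.testBit_succ, Nat.testBit_succ]
        have : (2 * j + 1) / 2 = j := by omega
        have h3 : (2 * j) / 2 = j := by omega
        rw [this, h3]; simp
  refine ⟨q, ?_, ?_, ?_⟩
  · rw [Nat.testBit_two_pow_mul]; simp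
  · rw [key, Nat.mul_add, Nat.mul_one]; omega
  · intro i
    rw [key, Nat.testBit_two_pow_mul, Nat.testBit_two_pow_mul]
    by_cases hqi : q ≤ i
    · simp only [hqi, decide_true, Bool.true_and]
      rcases Nat.eq_zero_or_pos (i - q) with h0 | h0
      · have : i = q := by omega
        subst this; simp
      · obtain ⟨d, hd⟩ : ∃ d, i - q = d + 1 := ⟨i - q - 1, by omega⟩
        have hne : i ≠ q := by omega
        rw [hd, Nat.testBit_succ, Nat.testBit_succ]
        have : (2 * j + 1) / 2 = j := by omega
        have h3 : (2 * j) / 2 = j := by omega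
        rw [this, h3]; simp [hne]
    · simp [hqi]

theorem forBits_sound (s : ℕ) (k : ℕ → Bool) : ∀ (fuel m : ℕ),
    forBits s k fuel m = true → ∀ q, m.testBit q = true → k (2 ^ q) = true := by
  intro fuel
  induction fuel with
  | zero => intro m h; exact absurd h (by simp [forBits])
  | succ f ih =>
    intro m h q hq
    cases m with
    | zero => simp at hq
    | succ m' =>
      have h' : force s (Nat.land (m' + 1) m') (fun r =>
        andb (k (Nat.sub (m' + 1) r)) (forBits s k f r)) = true := h
      rw [force_eq, andb_eq, Bool.and_eq_true] at h'
      obtain ⟨q0, h1, h2, h3⟩ := land_pred (m := m' + 1) (by omega)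
      rw [Nat.add_sub_cancel] at h2 h3
      by_cases hqq : q = q0
      · subst hqq
        have := h'.1
        rwa [show Nat.sub (m' + 1) (Nat.land (m' + 1) m') = 2 ^ q from h2] at this
      · apply ih _ h'.2 q
        rw [h3, hq]; simp [hqq]

theorem popLe_sound (s : ℕ) : ∀ (n m : ℕ), popLe s n m = true →
    ∀ A : Finset ℕ, (∀ i ∈ A, m.testBit i = true) → A.card ≤ n := by
  intro n
  induction n with
  | zero =>
    intro m h A hA
    have hm : m = 0 := Nat.eq_of_beq_eq_true h
    subst hm
    have : A = ∅ := Finset.eq_empty_of_forall_notMem fun i hi => by simpa using hA i hi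
    simp [this]
  | succ n ih =>
    intro m h A hA
    cases m with
    | zero =>
      have : A = ∅ := Finset.eq_empty_of_forall_notMem fun i hi => by simpa using hA i hi
      simp [this]
    | succ m' =>
      have h' : popLe s n (Nat.land (m' + 1) m') = true := h
      obtain ⟨q0, h1, h2, h3⟩ := land_pred (m := m' + 1) (by omega)
      rw [Nat.add_sub_cancel] at h3
      have := ih _ h' (A.erase q0) (by
        intro i hi
        rw [Finset.mem_erase] at hi
        rw [h3, hA i hi.2]; simp [hi.1])
      have h4 := Finset.pred_card_le_card_erase (s := A) (a := q0)
      omega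

/-- Offsets of the four cells of an orientation. -/
def off (o : O) : List ℕ := [0, o.k1, o.k2, o.k3]

theorem tb_lor (a b i : ℕ) : (Nat.lor a b).testBit i = (a.testBit i || b.testBit i) :=
  Nat.testBit_lor a b i
theorem tb_land (a b i : ℕ) : (Nat.land a b).testBit i = (a.testBit i && b.testBit i) :=
  Nat.testBit_land a b i
theorem tb_xor (a b i : ℕ) : (Nat.xor a b).testBit i = (a.testBit i ^^ b.testBit i) :=
  Nat.testBit_xor a b i
theorem tb_shl (a n i : ℕ) :
    (Nat.shiftLeft a n).testBit i = (decide (n ≤ i) && a.testBit (i - n)) :=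
  Nat.testBit_shiftLeft a
theorem tb_shr (a n i : ℕ) : (Nat.shiftRight a n).testBit i = a.testBit (i + n) := by
  rw [Nat.add_comm]; exact Nat.testBit_shiftRight a

theorem tb_diff (a b i : ℕ) : (diffN a b).testBit i = (a.testBit i && !b.testBit i) := by
  rw [diffN, tb_xor, tb_land]
  cases a.testBit i <;> cases b.testBit i <;> rfl

theorem tb_mul (a p i : ℕ) :
    (Nat.mul a (2 ^ p)).testBit i = (decide (p ≤ i) && a.testBit (i - p)) :=
  Nat.testBit_mul_two_pow a i p

theorem tb_hits (o : O) (h i : ℕ) :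
    (hits o h).testBit i = true ↔ ∃ k ∈ off o, h.testBit (i + k) = true := by
  simp only [hits, tb_lor, tb_shr, off]
  simp [or_assoc]

theorem tb_spread (o : O) (h i : ℕ) :
    (spread o h).testBit i = true ↔ ∃ k ∈ off o, k ≤ i ∧ h.testBit (i - k) = true := by
  simp only [spread, tb_lor, tb_shl, off]
  simp [or_assoc]

theorem tb_halo (m i : ℕ) : (halo m).testBit i = true ↔
    (1 ≤ i ∧ m.testBit (i - 1) = true) ∨ m.testBit (i + 1) = true ∨
    (42 ≤ i ∧ m.testBit (i - 42) = true) ∨ m.testBit (i + 42) = true := by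
  simp only [halo, tb_lor, tb_shl, tb_shr]
  simp [or_assoc]

/-- Adjacency of cell codes. -/
def NAdj (a b : ℕ) : Prop := a + 1 = b ∨ b + 1 = a ∨ a + 42 = b ∨ b + 42 = a

def Ov (c d : O × ℕ) : Prop := ∃ k ∈ off c.1, ∃ l ∈ off d.1, c.2 + k = d.2 + l
def AdN (c d : O × ℕ) : Prop := ∃ k ∈ off c.1, ∃ l ∈ off d.1, NAdj (c.2 + k) (d.2 + l)

/-- Offsets are small. -/
def Small (o : O) : Prop := ∀ k ∈ off o, k ≤ 126

theorem tabV_iff {q o : O} (hq : Small q) (ho : Small o) (p p' : ℕ) :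
    (Nat.mul (tabV q o) (2 ^ p)).testBit (p' + 200) = true ↔ Ov (q, p) (o, p') := by
  rw [tb_mul, Bool.and_eq_true, decide_eq_true_eq, tabV, tb_hits]
  simp only [tb_spread, Nat.testBit_two_pow, decide_eq_true_eq]
  constructor
  · rintro ⟨h, l, hl, k, hk, hkl, e⟩
    exact ⟨k, hk, l, hl, by dsimp only; omega⟩
  · rintro ⟨k, hk, l, hl, e⟩
    have := hq k hk
    have := ho l hl
    dsimp only at e
    exact ⟨by omega, l, hl, k, hk, by omega, by omega⟩

theorem tabH_iff {q o : O} (hq : Small q) (ho : Small o) (p p' : ℕ) :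
    (Nat.mul (tabH q o) (2 ^ p)).testBit (p' + 200) = true ↔ AdN (q, p) (o, p') := by
  rw [tb_mul, Bool.and_eq_true, decide_eq_true_eq, tabH, tb_hits]
  simp only [tb_halo, tb_spread, Nat.testBit_two_pow, decide_eq_true_eq]
  constructor
  · rintro ⟨h, l, hl, h'⟩
    rcases h' with ⟨h1, k, hk, h2, h3⟩ | ⟨k, hk, h2, h3⟩ | ⟨h1, k, hk, h2, h3⟩ | ⟨k, hk, h2, h3⟩ <;>
      exact ⟨k, hk, l, hl, by unfold NAdj; dsimp only; omega⟩
  · rintro ⟨k, hk, l, hl, e⟩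
    have := hq k hk
    have := ho l hl
    unfold NAdj at e
    dsimp only at e
    refine ⟨by omega, l, hl, ?_⟩
    rcases e with e | e | e | e
    · exact Or.inl ⟨by omega, k, hk, by omega, by omega⟩
    · exact Or.inr (Or.inl ⟨k, hk, by omega, by omega⟩)
    · exact Or.inr (Or.inr (Or.inl ⟨by omega, k, hk, by omega, by omega⟩))
    · exact Or.inr (Or.inr (Or.inr ⟨k, hk, by omega, by omega⟩))

/-- The meaning of a requirement. -/
def Rel (r : R) (c d : O × ℕ) : Prop :=
  match r with
  | .d => ¬ Ov c d
  | .a => ¬ Ov c d ∧ AdN c d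
  | .n => ¬ Ov c d ∧ ¬ AdN c d

theorem mul_lor (a b p : ℕ) : Nat.mul (Nat.lor a b) (2 ^ p)
    = Nat.lor (Nat.mul a (2 ^ p)) (Nat.mul b (2 ^ p)) := by
  apply Nat.eq_of_testBit_eq; intro i
  rw [tb_mul, tb_lor, tb_lor, tb_mul, tb_mul]
  cases decide (p ≤ i) <;> simp

theorem mul_diff (a b p : ℕ) : Nat.mul (diffN a b) (2 ^ p)
    = diffN (Nat.mul a (2 ^ p)) (Nat.mul b (2 ^ p)) := by
  apply Nat.eq_of_testBit_eq; intro i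
  rw [tb_mul, tb_diff, tb_diff, tb_mul, tb_mul]
  cases decide (p ≤ i) <;> simp

theorem updOne_sound {r : R} {q o : O} (hq : Small q) (ho : Small o) {p p' D : ℕ}
    (hD : D.testBit (p' + 200) = true) (h : Rel r (q, p) (o, p')) :
    (updOne r q o (2 ^ p) D).testBit (p' + 200) = true := by
  have hV := tabV_iff hq ho p p'
  have hH := tabH_iff hq ho p p'
  cases r with
  | d =>
    show (diffN D (Nat.mul (tabV q o) (2 ^ p))).testBit _ = true
    rw [tb_diff, hD, Bool.true_and, Bool.not_eq_true', ← Bool.not_eq_true, hV]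
    exact h
  | a =>
    show (Nat.land D (Nat.mul (tabA q o) (2 ^ p))).testBit _ = true
    rw [tb_land, hD, Bool.true_and, tabA, mul_diff, tb_diff, Bool.and_eq_true,
      Bool.not_eq_true', ← Bool.not_eq_true, hV, hH]
    exact ⟨h.2, h.1⟩
  | n =>
    show (diffN D (Nat.mul (tabN q o) (2 ^ p))).testBit _ = true
    rw [tb_diff, hD, Bool.true_and, Bool.not_eq_true', ← Bool.not_eq_true, tabN, mul_lor, tb_lor,
      Bool.or_eq_true, hV, hH]
    rintro (h' | h')
    · exact h.2 h'
    · exact h.1 h'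

/-- A placement is allowed by a list of domains. -/
def InDom (dom : List (O × ℕ)) (c : O × ℕ) : Prop :=
  ∃ D, (c.1, D) ∈ dom ∧ D.testBit (c.2 + 200) = true

theorem updDom_sound {s : ℕ} {r : R} {q : O} {p : ℕ} (hq : Small q) {c : O × ℕ}
    (hc : Small c.1) (h : Rel r (q, p) c) (l : List (O × ℕ)) :
    ∀ k : List (O × ℕ) → Bool, updDom s r q (2 ^ p) l k = true →
    ∃ l', k l' = true ∧ (InDom l c → InDom l' c) := by
  induction l with
  | nil => intro k hk; exact ⟨[], hk, id⟩
  | cons x xs ih =>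
    obtain ⟨o, D⟩ := x
    intro k hk
    have hk' : ifz s (updOne r q o (2 ^ p) D) (updDom s r q (2 ^ p) xs k) (fun D =>
      updDom s r q (2 ^ p) xs fun l' => k ((o, D) :: l')) = true := hk
    rw [ifz_eq] at hk'
    split at hk'
    · rename_i h0
      obtain ⟨l', h1, h2⟩ := ih _ hk'
      refine ⟨l', h1, ?_⟩
      rintro ⟨E, hE, hb⟩
      rcases List.mem_cons.1 hE with he | he
      · exfalso
        obtain ⟨co, cp⟩ := c
        simp only [Prod.mk.injEq] at he
        obtain ⟨rfl, rfl⟩ := he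
        have := updOne_sound hq hc hb h
        rw [h0] at this
        simp at this
      · exact h2 ⟨E, he, hb⟩
    · obtain ⟨l', h1, h2⟩ := ih _ hk'
      refine ⟨_, h1, ?_⟩
      rintro ⟨E, hE, hb⟩
      rcases List.mem_cons.1 hE with he | he
      · obtain ⟨co, cp⟩ := c
        simp only [Prod.mk.injEq] at he
        obtain ⟨rfl, rfl⟩ := he
        exact ⟨_, List.mem_cons_self, updOne_sound hq hc hb h⟩
      · obtain ⟨E', h3, h4⟩ := h2 ⟨E, he, hb⟩
        exact ⟨E', List.mem_cons_of_mem _ h3, h4⟩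

/-- A slot is compatible with a plan entry at depth `n`. -/
def SlotOK (cfg : ℕ → O × ℕ) (n : ℕ) (x : Slot) (y : ℕ × List R) : Prop :=
  x.ty = y.1 ∧ x.req = y.2.drop n ∧ InDom x.dom (cfg y.1)

theorem updSlots_sound {s n : ℕ} {q : O} {p : ℕ} (hq : Small q) {cfg : ℕ → O × ℕ}
    (hc : ∀ i, Small (cfg i).1) {l : List Slot} {ys : List (ℕ × List R)}
    (hl : List.Forall₂ (SlotOK cfg n) l ys)
    (hr : ∀ y ∈ ys, ∃ h, y.2[n]? = some h ∧ Rel h (q, p) (cfg y.1)) :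
    ∀ k : List Slot → Bool, updSlots s q (2 ^ p) l k = true →
    ∃ l', k l' = true ∧ List.Forall₂ (SlotOK cfg (n + 1)) l' ys := by
  induction hl with
  | nil => intro k hk; exact ⟨[], hk, List.Forall₂.nil⟩
  | @cons x y xs ys hxy _ ih =>
    intro k hk
    obtain ⟨ty, req, dom⟩ := x
    obtain ⟨h1, h2, h3⟩ := hxy
    obtain ⟨r, hr1, hr2⟩ := hr y List.mem_cons_self
    dsimp only at h1 h2 h3
    have hreq : req = r :: y.2.drop (n + 1) := by
      rw [h2]
      obtain ⟨hlt, he⟩ := List.getElem?_eq_some_iff.1 hr1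
      rw [List.drop_eq_getElem_cons hlt, he]
    subst hreq
    have hk' : updDom s r q (2 ^ p) dom (fun d =>
        List.rec (motive := fun _ => Bool) true
          (fun _ _ _ => updSlots s q (2 ^ p) xs fun l' => k (⟨ty, y.2.drop (n + 1), d⟩ :: l')) d)
        = true := hk
    obtain ⟨d, hd1, hd2⟩ := updDom_sound hq (hc y.1) hr2 dom _ hk'
    have hd3 := hd2 h3
    cases d with
    | nil => obtain ⟨D, hD, _⟩ := hd3; simp at hD
    | cons d0 ds =>
      dsimp only at hd1
      obtain ⟨l', hl1, hl2⟩ := ih (fun y' hy' => hr y' (List.mem_cons_of_mem _ hy')) _ hd1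
      exact ⟨_, hl1, List.Forall₂.cons ⟨h1, rfl, hd3⟩ hl2⟩

theorem allDom_sound {l : List (O × ℕ)} {k : O → ℕ → Bool} (h : allDom l k = true) :
    ∀ x ∈ l, k x.1 x.2 = true := by
  induction l with
  | nil => simp
  | cons x xs ih =>
    obtain ⟨o, D⟩ := x
    have h' : andb (k o D) (allDom xs k) = true := h
    rw [andb_eq, Bool.and_eq_true] at h'
    intro y hy
    rcases List.mem_cons.1 hy with rfl | hy
    · exact h'.1
    · exact ih h'.2 y hy

theorem unionDom_sound {l : List (O × ℕ)} {o : O} {D k i : ℕ} (h : (o, D) ∈ l)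
    (hk : k ∈ off o) (hi : D.testBit i = true) : (unionDom l).testBit (i + k) = true := by
  induction l with
  | nil => simp at h
  | cons x xs ih =>
    obtain ⟨o', D'⟩ := x
    show (Nat.lor (spread o' D') (unionDom xs)).testBit _ = true
    rw [tb_lor, Bool.or_eq_true]
    rcases List.mem_cons.1 h with h | h
    · simp only [Prod.mk.injEq] at h
      obtain ⟨rfl, rfl⟩ := h
      left
      rw [tb_spread]
      exact ⟨k, hk, by omega, by rwa [Nat.add_sub_cancel]⟩
    · exact Or.inr (ih h)

theorem filt_sound {n : ℕ} {o : O} {p : ℕ} {cfg : ℕ → O × ℕ} {l : List Slot}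
    {ys : List (ℕ × List R)} (hl : List.Forall₂ (SlotOK cfg n) l ys) (hp : p + 200 < 1100)
    (hr : ∀ y ∈ ys, ∃ h, y.2[n]? = some h ∧ Rel h (o, p) (cfg y.1)) :
    (hits o (filt l)).testBit (p + 200) = true := by
  induction hl with
  | nil =>
    rw [tb_hits]
    refine ⟨0, by simp [off], ?_⟩
    show (2 ^ 1100 - 1).testBit _ = true
    rw [Nat.testBit_two_pow_sub_one]
    simpa using hp
  | @cons x y xs ys hxy _ ih =>
    obtain ⟨ty, req, dom⟩ := x
    obtain ⟨h1, h2, h3⟩ := hxy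
    obtain ⟨r, hr1, hr2⟩ := hr y List.mem_cons_self
    have ih' := ih (fun y' hy' => hr y' (List.mem_cons_of_mem _ hy'))
    dsimp only at h1 h2 h3
    have hreq : req = r :: y.2.drop (n + 1) := by
      rw [h2]
      obtain ⟨hlt, he⟩ := List.getElem?_eq_some_iff.1 hr1
      rw [List.drop_eq_getElem_cons hlt, he]
    subst hreq
    cases r with
    | d => exact ih'
    | n => exact ih'
    | a =>
      show (hits o (halo (unionDom dom))).testBit (p + 200) = true
      obtain ⟨-, k, hk, m, hm, e⟩ := hr2
      obtain ⟨D, hD, hb⟩ := h3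
      have hu := unionDom_sound hD hm hb
      rw [tb_hits]
      refine ⟨k, hk, ?_⟩
      rw [tb_halo]
      unfold NAdj at e
      dsimp only at e
      rcases e with e | e | e | e
      · right; left
        rwa [show p + 200 + k + 1 = (cfg y.1).2 + 200 + m by omega]
      · left
        refine ⟨by omega, ?_⟩
        rwa [show p + 200 + k - 1 = (cfg y.1).2 + 200 + m by omega]
      · right; right; right
        rwa [show p + 200 + k + 42 = (cfg y.1).2 + 200 + m by omega]
      · right; right; left
        refine ⟨by omega, ?_⟩
        rwa [show p + 200 + k - 42 = (cfg y.1).2 + 200 + m by omega]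

/-- All requirements of a plan hold in a configuration. -/
def SatR (cfg : ℕ → O × ℕ) : ℕ → List (ℕ × List R) → Prop
  | _, [] => True
  | n, x :: xs => (∀ y ∈ xs, ∃ h, y.2[n]? = some h ∧ Rel h (cfg x.1) (cfg y.1)) ∧
      SatR cfg (n + 1) xs

/-- The accumulated smear, for a placed piece. -/
noncomputable def smC (c : O × ℕ) : ℕ := Nat.mul (smO c.1) (2 ^ c.2)
noncomputable def maskC (c : O × ℕ) : ℕ := Nat.mul (maskO c.1) (2 ^ c.2)

theorem search_sound {known : List (List ℕ)} {cfg : ℕ → O × ℕ}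
    (hc : ∀ i, Small (cfg i).1) (hp : ∀ i, (cfg i).2 + 200 < 1100) :
    ∀ (ys : List (ℕ × List R)) (n s Z S : ℕ) (pl : List (ℕ × ℕ)) (slots : List Slot),
    search known ys.length s Z S pl slots = true →
    List.Forall₂ (SlotOK cfg n) slots ys → SatR cfg n ys →
    ∃ s' Z' S' pl', leaf known s' Z' S' pl' = true ∧
      (∀ i, Z.testBit i = true → Z'.testBit i = true) ∧
      (∀ y ∈ ys, ∀ i, (smC (cfg y.1)).testBit i = true → Z'.testBit i = true) ∧
      (∀ i, S'.testBit i = true → S.testBit i = true ∨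
        ∃ y ∈ ys, (maskC (cfg y.1)).testBit i = true) ∧
      (∀ x ∈ pl, x ∈ pl') ∧ (∀ y ∈ ys, (y.1, maskC (cfg y.1)) ∈ pl') := by
  intro ys
  induction ys with
  | nil =>
    intro n s Z S pl slots h hs _
    exact ⟨s, Z, S, pl, h, fun _ h => h, by simp, fun _ h => Or.inl h, fun _ h => h, by simp⟩
  | cons y ys ih =>
    intro n s Z S pl slots h hs hsat
    cases hs with
    | @cons x _ rest _ hx hrest =>
    obtain ⟨ty, req, dom⟩ := x
    obtain ⟨h1, h2, h3⟩ := hx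
    dsimp only at h1 h2 h3
    subst h1
    have h' : force s (filt rest) (fun F =>
          allDom dom fun o D => forBits s (fun c =>
          force s (Nat.shiftRight c 200) fun b =>
          forceS (Nat.mod (Nat.add (Nat.mul s 33) b) 2147483629) fun s =>
          updSlots s o b rest fun rest' =>
          force s (Nat.lor Z (Nat.mul (smO o) b)) fun Z =>
          force s (Nat.lor S (Nat.mul (maskO o) b)) fun S =>
          search known ys.length s Z S ((y.1, Nat.mul (maskO o) b) :: pl) rest') 300
            (Nat.land D (hits o F))) = true := h
    clear h
    rw [force_eq] at h'
    obtain ⟨D, hD, hb⟩ := h3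
    have h4 := allDom_sound h' _ hD
    dsimp only at h4
    have h5 := forBits_sound _ _ _ _ h4 ((cfg y.1).2 + 200) (by
      rw [tb_land, hb, Bool.true_and]
      exact filt_sound hrest (hp _) hsat.1)
    have h6 : Nat.shiftRight (2 ^ ((cfg y.1).2 + 200)) 200 = 2 ^ (cfg y.1).2 := by
      show 2 ^ ((cfg y.1).2 + 200) >>> 200 = _
      rw [Nat.shiftRight_eq_div_pow, Nat.pow_add, Nat.mul_div_cancel _ (Nat.two_pow_pos _)]
    rw [force_eq, forceS_eq, h6] at h5
    obtain ⟨rest', h7, h8⟩ := updSlots_sound (hc y.1) hc hrest hsat.1 _ h5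
    rw [force_eq, force_eq] at h7
    obtain ⟨s', Z', S', pl', a1, a2, a3, a4, a5, a6⟩ := ih _ _ _ _ _ _ h7 h8 hsat.2
    refine ⟨s', Z', S', pl', a1, ?_, ?_, ?_, ?_, ?_⟩
    · intro i hi
      apply a2; rw [tb_lor, hi]; rfl
    · intro z hz i hi
      rcases List.mem_cons.1 hz with rfl | hz
      · apply a2; rw [tb_lor, Bool.or_eq_true]; exact Or.inr hi
      · exact a3 z hz i hi
    · intro i hi
      rcases a4 i hi with h | ⟨z, hz, h⟩
      · rw [tb_lor, Bool.or_eq_true] at h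
        rcases h with h | h
        · exact Or.inl h
        · exact Or.inr ⟨y, List.mem_cons_self, h⟩
      · exact Or.inr ⟨z, List.mem_cons_of_mem _ hz, h⟩
    · intro x hx; exact a5 x (List.mem_cons_of_mem _ hx)
    · intro z hz
      rcases List.mem_cons.1 hz with rfl | hz
      · exact a5 _ List.mem_cons_self
      · exact a6 z hz

/-! ### The leaf test -/

/-- A cell code with occupied cells in all four directions. -/
def Sh (cfg : ℕ → O × ℕ) (e : ℕ) : Prop :=
  (∃ i < 5, ∃ k ∈ off (cfg i).1, ∃ j < 21, (cfg i).2 + k + j = e) ∧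
  (∃ i < 5, ∃ k ∈ off (cfg i).1, ∃ j < 21, (cfg i).2 + k = e + j) ∧
  (∃ i < 5, ∃ k ∈ off (cfg i).1, ∃ j < 21, (cfg i).2 + k + 42 * j = e) ∧
  (∃ i < 5, ∃ k ∈ off (cfg i).1, ∃ j < 21, (cfg i).2 + k = e + 42 * j) ∧
  (∀ i < 5, ∀ k ∈ off (cfg i).1, (cfg i).2 + k ≠ e)

theorem sm0_bits : ∀ j < 21, sm0.testBit (840 + j) = true ∧ sm0.testBit (3440 - j) = true ∧
    sm0.testBit (6040 + 42 * j) = true ∧ sm0.testBit (8640 - 42 * j) = true := by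
  decide +kernel

theorem smC_bit {c : O × ℕ} {k i : ℕ} (hk : k ∈ off c.1) (hi : sm0.testBit i = true) :
    (smC c).testBit (c.2 + k + i) = true := by
  rw [smC, tb_mul, Bool.and_eq_true, decide_eq_true_eq, smO, tb_spread]
  refine ⟨by omega, k, hk, by omega, ?_⟩
  rwa [show c.2 + k + i - c.2 - k = i by omega]

theorem maskC_bit (c : O × ℕ) (n : ℕ) :
    (maskC c).testBit (840 + n) = true ↔ ∃ k ∈ off c.1, c.2 + k = n := by
  rw [maskC, tb_mul, Bool.and_eq_true, decide_eq_true_eq, maskO, tb_spread]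
  simp only [Nat.testBit_two_pow, decide_eq_true_eq]
  constructor
  · rintro ⟨h, k, hk, h2, h3⟩; exact ⟨k, hk, by omega⟩
  · rintro ⟨k, hk, h⟩; exact ⟨by omega, k, hk, by omega, by omega⟩

/-- The conclusion of the search for one configuration. -/
def LeafOK (known : List (List ℕ)) (cfg : ℕ → O × ℕ) : Prop :=
  (∀ A : Finset ℕ, (∀ e ∈ A, Sh cfg e) → A.card ≤ 8) ∨
  ((∀ A : Finset ℕ, (∀ e ∈ A, Sh cfg e) → A.card ≤ 9) ∧
    ∃ K ∈ known, ∀ t < 5, K.getD t 0 = maskC (cfg t))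

theorem run_sound {known : List (List ℕ)} {cfg : ℕ → O × ℕ} {pl : List (ℕ × List R)}
    (hrun : run known pl = true) (hlen : pl.length = 4)
    (hall : ∀ t < 5, t = 1 ∨ t ∈ pl.map Prod.fst) (hlt : ∀ t ∈ pl.map Prod.fst, t < 5)
    (hc : ∀ i, Small (cfg i).1) (hp : ∀ i, (cfg i).2 + 200 < 1100)
    (hori : ∀ i < 5, (cfg i).1 ∈ ori i) (h1 : cfg 1 = (⟨1, 42, 84⟩, 430))
    (hsat : SatR cfg 0 ((1, []) :: pl)) : LeafOK known cfg := by
  have hys : ((1, []) :: pl : List (ℕ × List R)).length = 5 := by simp [hlen]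
  have hok : List.Forall₂ (SlotOK cfg 0)
      (⟨1, [], [(⟨1, 42, 84⟩, 2 ^ 630)]⟩ :: mkSlots pl) ((1, []) :: pl) := by
    refine List.Forall₂.cons ⟨rfl, rfl, 2 ^ 630, ?_, ?_⟩ ?_
    · rw [h1]; exact List.mem_cons_self
    · rw [h1, Nat.testBit_two_pow]; simp
    · rw [mkSlots, List.forall₂_map_left_iff, List.forall₂_same]
      intro y hy
      refine ⟨rfl, rfl, 2 ^ 1100 - 1, ?_, ?_⟩
      · exact List.mem_map.2 ⟨_, hori y.1 (hlt _ (List.mem_map_of_mem hy)), rfl⟩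
      · rw [Nat.testBit_two_pow_sub_one]; simpa using hp y.1
  have hrun' : search known ((1, []) :: pl : List (ℕ × List R)).length 7 0 0 []
    (⟨1, [], [(⟨1, 42, 84⟩, 2 ^ 630)]⟩ :: mkSlots pl) = true := by rw [hys]; exact hrun
  obtain ⟨s, Z, S, pl', a1, -, a3, a4, -, a6⟩ := search_sound hc hp _ 0 7 0 0 [] _ hrun' hok hsat
  have hall' : ∀ t < 5, ∃ y ∈ ((1, []) :: pl : List (ℕ × List R)), y.1 = t := by
    intro t ht
    rcases hall t ht with rfl | h
    · exact ⟨_, List.mem_cons_self, rfl⟩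
    · obtain ⟨y, hy, e⟩ := List.mem_map.1 h
      exact ⟨y, List.mem_cons_of_mem _ hy, e⟩
  have hZ : ∀ t < 5, ∀ k ∈ off (cfg t).1, ∀ i, sm0.testBit i = true →
      Z.testBit ((cfg t).2 + k + i) = true := by
    intro t ht k hk i hi
    obtain ⟨y, hy, rfl⟩ := hall' t ht
    exact a3 y hy _ (smC_bit hk hi)
  rw [leaf, force_eq, force_eq] at a1
  set Y := Nat.land Z (Nat.shiftRight Z 2600) with hY
  set E := diffN (Nat.land Y (Nat.shiftRight Y 5200)) S with hE
  have hEb : ∀ e, Sh cfg e → E.testBit (840 + e) = true := by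
    rintro e ⟨⟨i1, hi1, k1, hk1, j1, hj1, e1⟩, ⟨i2, hi2, k2, hk2, j2, hj2, e2⟩,
      ⟨i3, hi3, k3, hk3, j3, hj3, e3⟩, ⟨i4, hi4, k4, hk4, j4, hj4, e4⟩, h5⟩
    have b1 := hZ i1 hi1 k1 hk1 _ (sm0_bits j1 hj1).1
    have b2 := hZ i2 hi2 k2 hk2 _ (sm0_bits j2 hj2).2.1
    have b3 := hZ i3 hi3 k3 hk3 _ (sm0_bits j3 hj3).2.2.1
    have b4 := hZ i4 hi4 k4 hk4 _ (sm0_bits j4 hj4).2.2.2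
    rw [show (cfg i1).2 + k1 + (840 + j1) = 840 + e by omega] at b1
    rw [show (cfg i2).2 + k2 + (3440 - j2) = 840 + e + 2600 by omega] at b2
    rw [show (cfg i3).2 + k3 + (6040 + 42 * j3) = 840 + e + 5200 by omega] at b3
    rw [show (cfg i4).2 + k4 + (8640 - 42 * j4) = 840 + e + 5200 + 2600 by omega] at b4
    have b5 : S.testBit (840 + e) = false := by
      rw [← Bool.not_eq_true]
      intro hS
      rcases a4 _ hS with h | ⟨y, hy, h⟩
      · simp at h
      · rw [maskC_bit] at h
        obtain ⟨k, hk, h⟩ := h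
        have hy5 : y.1 < 5 := by
          rcases List.mem_cons.1 hy with rfl | hy
          · decide
          · exact hlt _ (List.mem_map_of_mem hy)
        exact h5 y.1 hy5 k hk h
    rw [hE, tb_diff, tb_land, tb_shr, hY, tb_land, tb_land, tb_shr, tb_shr, b1, b2, b3, b4, b5]
    rfl
  have hcard : ∀ n, popLe s n E = true → ∀ A : Finset ℕ, (∀ e ∈ A, Sh cfg e) → A.card ≤ n := by
    intro n hn A hA
    have := popLe_sound s n E hn (A.image (840 + ·)) (by
      intro i hi
      obtain ⟨e, he, rfl⟩ := Finset.mem_image.1 hi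
      exact hEb e (hA e he))
    rwa [Finset.card_image_of_injective _ (add_right_injective 840)] at this
  rcases h8 : popLe s 8 E with _ | _
  · rw [h8] at a1
    have a1' : andb (popLe s 9 E) (knownChk known pl') = true := a1
    rw [andb_eq, Bool.and_eq_true, knownChk, List.any_eq_true] at a1'
    obtain ⟨b1, K, hK, b2⟩ := a1'
    rw [List.all_eq_true] at b2
    refine Or.inr ⟨hcard 9 b1, K, hK, ?_⟩
    intro t ht
    obtain ⟨y, hy, rfl⟩ := hall' t ht
    exact Nat.eq_of_beq_eq_true (b2 _ (a6 y hy))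
  · exact Or.inl (hcard 8 h8)

/-! ### Plans cover all adjacency graphs -/

def relB (r : R) (b : Bool) : Bool :=
  match r with
  | .d => true
  | .a => b
  | .n => !b

def satB (g : ℕ → ℕ → Bool) : ℕ → List (ℕ × List R) → Bool
  | _, [] => true
  | n, x :: xs => (xs.all fun y => (match y.2[n]? with
      | some h => relB h (g x.1 y.1)
      | none => false) && (x.1 != y.1) && Nat.blt y.1 5 && Nat.blt x.1 5) && satB g (n + 1) xs

theorem satB_sound {g : ℕ → ℕ → Bool} {cfg : ℕ → O × ℕ}
    (hd : ∀ i < 5, ∀ j < 5, i ≠ j → ¬ Ov (cfg i) (cfg j))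
    (hg : ∀ i < 5, ∀ j < 5, i ≠ j → (g i j = true ↔ AdN (cfg i) (cfg j))) :
    ∀ (l : List (ℕ × List R)) (n : ℕ), satB g n l = true → SatR cfg n l := by
  intro l
  induction l with
  | nil => intro n _; trivial
  | cons x xs ih =>
    intro n h
    rw [satB, Bool.and_eq_true, List.all_eq_true] at h
    refine ⟨?_, ih _ h.2⟩
    intro y hy
    have := h.1 y hy
    simp only [Bool.and_eq_true, bne_iff_ne, ne_eq] at this
    obtain ⟨⟨⟨h1, h2⟩, h3⟩, h4⟩ := this
    have h3 : y.1 < 5 := by simpa [Nat.blt_eq] using h3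
    have h4 : x.1 < 5 := by simpa [Nat.blt_eq] using h4
    have hov := hd _ h4 _ h3 h2
    have had := hg _ h4 _ h3 h2
    rcases hh : y.2[n]? with _ | r
    · rw [hh] at h1; simp at h1
    · rw [hh] at h1
      refine ⟨r, rfl, ?_⟩
      cases r with
      | d => exact hov
      | a => exact ⟨hov, had.1 h1⟩
      | n =>
        refine ⟨hov, ?_⟩
        rw [← had]
        simpa [relB] using h1

def gl (b01 b02 b03 b04 b12 b13 b14 b23 b24 b34 : Bool) (i j : ℕ) : Bool :=
  match i, j with
  | 0, 1 => b01 | 1, 0 => b01 | 0, 2 => b02 | 2, 0 => b02 | 0, 3 => b03 | 3, 0 => b03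
  | 0, 4 => b04 | 4, 0 => b04 | 1, 2 => b12 | 2, 1 => b12 | 1, 3 => b13 | 3, 1 => b13
  | 1, 4 => b14 | 4, 1 => b14 | 2, 3 => b23 | 3, 2 => b23 | 2, 4 => b24 | 4, 2 => b24
  | 3, 4 => b34 | 4, 3 => b34 | _, _ => false

def deg2 (g : ℕ → ℕ → Bool) : Bool :=
  (List.range 5).all fun i =>
    Nat.ble 2 ((g i 0).toNat + (g i 1).toNat + (g i 2).toNat + (g i 3).toNat + (g i 4).toNat)

def near1 (g : ℕ → ℕ → Bool) : Bool :=
  (List.range 5).all fun i =>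
    i == 1 || g 1 i || (List.range 5).any fun j => g 1 j && g j i

/-- The plans: order of placement and requirements. -/
def plans : List (List (ℕ × List R)) := [
  [(4, [.a]), (0, [.a, .d]), (3, [.d, .a, .d]), (2, [.d, .d, .a, .a])],
  [(0, [.a]), (3, [.a, .d]), (2, [.d, .a, .d]), (4, [.d, .d, .a, .a])],
  [(0, [.a]), (4, [.a, .d]), (3, [.d, .a, .d]), (2, [.d, .d, .a, .a])],
  [(0, [.a]), (2, [.a, .d]), (3, [.d, .a, .d]), (4, [.d, .d, .a, .a])],
  [(3, [.a]), (0, [.a, .d]), (2, [.d, .a, .d]), (4, [.d, .d, .a, .a])],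
  [(2, [.a]), (0, [.a, .d]), (3, [.d, .a, .d]), (4, [.d, .d, .a, .a])],
  [(4, [.a]), (2, [.a, .d]), (3, [.d, .a, .d]), (0, [.d, .d, .a, .a])],
  [(2, [.a]), (3, [.a, .d]), (0, [.d, .a, .d]), (4, [.d, .d, .a, .a])],
  [(2, [.a]), (4, [.a, .d]), (3, [.d, .a, .d]), (0, [.d, .d, .a, .a])],
  [(3, [.a]), (2, [.a, .d]), (0, [.d, .a, .d]), (4, [.d, .d, .a, .a])],
  [(3, [.a]), (4, [.a, .d]), (0, [.d, .a, .d]), (2, [.d, .d, .a, .a])],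
  [(4, [.a]), (3, [.a, .d]), (0, [.d, .a, .d]), (2, [.d, .d, .a, .a])],
  [(0, [.a]), (2, [.a, .a]), (3, [.a, .n, .n]), (4, [.a, .n, .n, .a])],
  [(0, [.a]), (3, [.a, .a]), (2, [.a, .n, .n]), (4, [.a, .n, .n, .a])],
  [(0, [.a]), (4, [.a, .a]), (2, [.a, .n, .n]), (3, [.a, .n, .n, .a])],
  [(0, [.a]), (2, [.a, .a]), (3, [.n, .a, .n]), (4, [.n, .a, .n, .a])],
  [(0, [.a]), (3, [.a, .a]), (2, [.n, .a, .n]), (4, [.n, .a, .n, .a])],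
  [(0, [.a]), (4, [.a, .a]), (2, [.n, .a, .n]), (3, [.n, .a, .n, .a])],
  [(2, [.a]), (0, [.a, .a]), (3, [.n, .a, .n]), (4, [.n, .a, .n, .a])],
  [(2, [.a]), (3, [.a, .a]), (0, [.n, .a, .n]), (4, [.n, .a, .n, .a])],
  [(2, [.a]), (4, [.a, .a]), (0, [.n, .a, .n]), (3, [.n, .a, .n, .a])],
  [(3, [.a]), (0, [.a, .a]), (2, [.n, .a, .n]), (4, [.n, .a, .n, .a])],
  [(3, [.a]), (2, [.a, .a]), (0, [.n, .a, .n]), (4, [.n, .a, .n, .a])],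
  [(3, [.a]), (4, [.a, .a]), (0, [.n, .a, .n]), (2, [.n, .a, .n, .a])],
  [(4, [.a]), (0, [.a, .a]), (2, [.n, .a, .n]), (3, [.n, .a, .n, .a])],
  [(4, [.a]), (2, [.a, .a]), (0, [.n, .a, .n]), (3, [.n, .a, .n, .a])],
  [(4, [.a]), (3, [.a, .a]), (0, [.n, .a, .n]), (2, [.n, .a, .n, .a])],
  [(2, [.a]), (0, [.d, .a]), (3, [.a, .n, .a]), (4, [.a, .n, .a, .n])],
  [(0, [.a]), (2, [.d, .a]), (3, [.a, .n, .a]), (4, [.a, .n, .a, .n])],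
  [(0, [.a]), (3, [.d, .a]), (2, [.a, .n, .a]), (4, [.a, .n, .a, .n])],
  [(0, [.a]), (4, [.d, .a]), (2, [.a, .n, .a]), (3, [.a, .n, .a, .n])],
  [(0, [.a]), (2, [.a, .d]), (3, [.n, .a, .a]), (4, [.n, .a, .a, .n])],
  [(0, [.a]), (3, [.a, .d]), (2, [.n, .a, .a]), (4, [.n, .a, .a, .n])],
  [(0, [.a]), (4, [.a, .d]), (2, [.n, .a, .a]), (3, [.n, .a, .a, .n])],
  [(2, [.a]), (3, [.a, .d]), (0, [.n, .a, .a]), (4, [.n, .a, .a, .n])],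
  [(2, [.a]), (4, [.a, .d]), (0, [.n, .a, .a]), (3, [.n, .a, .a, .n])],
  [(3, [.a]), (4, [.a, .d]), (0, [.n, .a, .a]), (2, [.n, .a, .a, .n])]]


theorem cover : ∀ b01 b02 b03 b04 b12 b13 b14 b23 b24 b34 : Bool,
    (!deg2 (gl b01 b02 b03 b04 b12 b13 b14 b23 b24 b34) ||
    (near1 (gl b01 b02 b03 b04 b12 b13 b14 b23 b24 b34) &&
    plans.any fun pl => satB (gl b01 b02 b03 b04 b12 b13 b14 b23 b24 b34) 0 ((1, []) :: pl)))
      = true := by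
  decide +kernel

theorem plans_ok : ∀ pl ∈ plans, pl.length = 4 ∧ (∀ t < 5, t = 1 ∨ t ∈ pl.map Prod.fst) ∧
    (∀ t ∈ pl.map Prod.fst, t < 5) := by
  decide +kernel

theorem ori_small : ∀ t < 5, ∀ o ∈ ori t, ∀ k ∈ off o, k ≤ 126 := by
  decide +kernel

/-! ### The known solutions -/

/-- The 21 solutions: codes of cells with the type of the piece, each cell but the
first adjacent to an earlier one. -/
def sols : List (List (ℕ × ℕ)) := [
  [(430, 1), (472, 1), (514, 1), (556, 0), (557, 0), (558, 0), (559, 0), (431, 1), (560, 3),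
    (518, 3), (519, 3), (477, 2), (435, 2), (434, 2), (392, 2), (561, 3), (389, 4), (390, 4),
    (348, 4), (391, 4)],
  [(430, 1), (472, 1), (514, 1), (556, 0), (557, 0), (558, 0), (559, 0), (431, 1), (560, 2),
    (518, 2), (519, 2), (477, 2), (435, 3), (434, 3), (392, 3), (393, 3), (389, 4), (390, 4),
    (348, 4), (391, 4)],
  [(430, 1), (472, 1), (514, 1), (431, 1), (389, 0), (390, 0), (391, 0), (392, 0), (556, 2),
    (557, 2), (599, 2), (600, 2), (601, 3), (559, 3), (560, 3), (602, 3), (434, 4), (476, 4),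
    (518, 4), (477, 4)],
  [(430, 1), (472, 1), (514, 1), (431, 1), (389, 0), (390, 0), (391, 0), (392, 0), (556, 3),
    (598, 3), (557, 3), (599, 3), (600, 2), (601, 2), (559, 2), (560, 2), (434, 4), (476, 4),
    (518, 4), (477, 4)],
  [(430, 1), (472, 1), (514, 1), (431, 1), (432, 2), (433, 2), (475, 2), (476, 2), (556, 3),
    (598, 3), (557, 3), (599, 3), (641, 0), (642, 0), (643, 0), (644, 0), (518, 4), (560, 4),
    (602, 4), (561, 4)],
  [(430, 1), (472, 1), (514, 1), (431, 1), (432, 0), (433, 0), (434, 0), (435, 0), (556, 2),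
    (557, 2), (599, 2), (600, 2), (601, 3), (559, 3), (560, 3), (602, 3), (477, 4), (519, 4),
    (561, 4), (520, 4)],
  [(430, 1), (472, 1), (514, 1), (431, 1), (432, 0), (433, 0), (434, 0), (435, 0), (556, 3),
    (598, 3), (557, 3), (599, 3), (600, 2), (601, 2), (559, 2), (560, 2), (477, 4), (519, 4),
    (561, 4), (520, 4)],
  [(430, 1), (472, 1), (514, 1), (431, 1), (432, 0), (433, 0), (434, 0), (435, 0), (477, 2),
    (519, 2), (518, 2), (560, 2), (556, 3), (598, 3), (557, 3), (599, 3), (600, 4), (601, 4),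
    (643, 4), (602, 4)],
  [(430, 1), (472, 1), (514, 1), (431, 1), (432, 2), (433, 2), (475, 2), (476, 2), (556, 3),
    (598, 3), (557, 3), (599, 3), (600, 0), (601, 0), (602, 0), (603, 0), (477, 4), (519, 4),
    (561, 4), (520, 4)],
  [(430, 1), (472, 1), (514, 1), (431, 1), (556, 3), (598, 3), (557, 3), (599, 3), (600, 0),
    (601, 0), (602, 0), (603, 0), (561, 2), (519, 2), (518, 2), (476, 2), (432, 4), (433, 4),
    (391, 4), (434, 4)],
  [(430, 1), (472, 1), (514, 1), (431, 1), (556, 2), (557, 2), (599, 2), (600, 2), (601, 3),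
    (559, 3), (560, 3), (518, 0), (476, 0), (434, 0), (392, 0), (602, 3), (389, 4), (390, 4),
    (348, 4), (391, 4)],
  [(430, 1), (472, 1), (514, 1), (431, 1), (556, 3), (598, 3), (557, 3), (599, 3), (600, 2),
    (601, 2), (559, 2), (560, 2), (518, 0), (476, 0), (434, 0), (392, 0), (389, 4), (390, 4),
    (348, 4), (391, 4)],
  [(430, 1), (472, 1), (514, 1), (431, 1), (556, 2), (555, 2), (598, 2), (599, 2), (432, 3),
    (390, 3), (391, 3), (433, 3), (434, 0), (476, 0), (518, 0), (560, 0), (600, 4), (601, 4),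
    (643, 4), (602, 4)],
  [(430, 1), (472, 1), (514, 1), (431, 1), (556, 2), (598, 2), (599, 2), (641, 2), (432, 3),
    (390, 3), (391, 3), (433, 3), (434, 0), (476, 0), (518, 0), (560, 0), (600, 4), (601, 4),
    (643, 4), (602, 4)],
  [(430, 1), (472, 1), (514, 1), (431, 1), (556, 2), (555, 2), (598, 2), (599, 2), (600, 3),
    (642, 3), (601, 3), (602, 0), (560, 0), (518, 0), (476, 0), (643, 3), (432, 4), (433, 4),
    (391, 4), (434, 4)],
  [(430, 1), (472, 1), (514, 1), (431, 1), (556, 2), (598, 2), (599, 2), (641, 2), (432, 3),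
    (474, 3), (433, 3), (475, 3), (476, 0), (518, 0), (560, 0), (602, 0), (642, 4), (643, 4),
    (685, 4), (644, 4)],
  [(430, 1), (472, 1), (514, 1), (431, 1), (556, 2), (598, 2), (599, 2), (641, 2), (600, 3),
    (642, 3), (601, 3), (602, 0), (560, 0), (518, 0), (476, 0), (643, 3), (432, 4), (433, 4),
    (391, 4), (434, 4)],
  [(430, 1), (472, 1), (514, 1), (431, 1), (432, 2), (433, 2), (475, 2), (476, 2), (518, 0),
    (560, 0), (602, 0), (644, 0), (556, 3), (598, 3), (557, 3), (599, 3), (641, 4), (642, 4),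
    (684, 4), (643, 4)],
  [(430, 1), (472, 1), (514, 1), (431, 1), (556, 2), (557, 2), (599, 2), (600, 2), (601, 3),
    (559, 3), (560, 3), (561, 0), (519, 0), (477, 0), (435, 0), (602, 3), (432, 4), (433, 4),
    (391, 4), (434, 4)],
  [(430, 1), (472, 1), (514, 1), (431, 1), (556, 3), (598, 3), (557, 3), (599, 3), (600, 2),
    (601, 2), (559, 2), (560, 2), (561, 0), (519, 0), (477, 0), (435, 0), (432, 4), (433, 4),
    (391, 4), (434, 4)],
  [(430, 1), (472, 1), (514, 1), (431, 1), (432, 2), (433, 2), (475, 2), (476, 2), (477, 0),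
    (519, 0), (561, 0), (603, 0), (556, 3), (598, 3), (557, 3), (599, 3), (600, 4), (601, 4),
    (643, 4), (602, 4)]]

/-- Codes of the enclosed cells. -/
def encl : List (List ℕ) := [
  [432, 433, 473, 474, 475, 476, 515, 516, 517],
  [432, 433, 473, 474, 475, 476, 515, 516, 517],
  [432, 433, 473, 474, 475, 515, 516, 517, 558],
  [432, 433, 473, 474, 475, 515, 516, 517, 558],
  [473, 474, 515, 516, 517, 558, 559, 600, 601],
  [473, 474, 475, 476, 515, 516, 517, 518, 558],
  [473, 474, 475, 476, 515, 516, 517, 518, 558],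
  [473, 474, 475, 476, 515, 516, 517, 558, 559],
  [473, 474, 515, 516, 517, 518, 558, 559, 560],
  [473, 474, 475, 515, 516, 517, 558, 559, 560],
  [432, 433, 473, 474, 475, 515, 516, 517, 558],
  [432, 433, 473, 474, 475, 515, 516, 517, 558],
  [473, 474, 475, 515, 516, 517, 557, 558, 559],
  [473, 474, 475, 515, 516, 517, 557, 558, 559],
  [473, 474, 475, 515, 516, 517, 557, 558, 559],
  [473, 515, 516, 517, 557, 558, 559, 600, 601],
  [473, 474, 475, 515, 516, 517, 557, 558, 559],
  [473, 474, 515, 516, 517, 558, 559, 600, 601],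
  [473, 474, 475, 476, 515, 516, 517, 518, 558],
  [473, 474, 475, 476, 515, 516, 517, 518, 558],
  [473, 474, 515, 516, 517, 518, 558, 559, 560]]


/-- Codes of the cells of the piece of type `t`. -/
def codes (l : List (ℕ × ℕ)) (t : ℕ) : List ℕ :=
  (l.filter fun x => Nat.beq x.2 t).map Prod.fst

def maskL (l : List ℕ) : ℕ := l.foldr (fun n m => Nat.lor (2 ^ (840 + n)) m) 0

def known : List (List ℕ) := sols.map fun l =>
  [maskL (codes l 0), maskL (codes l 1), maskL (codes l 2), maskL (codes l 3), maskL (codes l 4)]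

theorem maskL_bit (l : List ℕ) (n : ℕ) : (maskL l).testBit (840 + n) = true ↔ n ∈ l := by
  induction l with
  | nil => simp [maskL]
  | cons x xs ih =>
    show (Nat.lor (2 ^ (840 + x)) (maskL xs)).testBit _ = true ↔ _
    rw [tb_lor, Bool.or_eq_true, ih, Nat.testBit_two_pow, List.mem_cons, decide_eq_true_eq]
    constructor
    · rintro (h | h)
      · left; omega
      · right; exact h
    · rintro (h | h)
      · left; omega
      · right; exact h

/-! ### Running the search -/

theorem run0 : run known (plans.getD 0 []) = true := by
  decide +kernel
theorem run1 : run known (plans.getD 1 []) = true := by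
  decide +kernel
theorem run2 : run known (plans.getD 2 []) = true := by
  decide +kernel
theorem run3 : run known (plans.getD 3 []) = true := by
  decide +kernel
theorem run4 : run known (plans.getD 4 []) = true := by
  decide +kernel
theorem run5 : run known (plans.getD 5 []) = true := by
  decide +kernel
theorem run6 : run known (plans.getD 6 []) = true := by
  decide +kernel
theorem run7 : run known (plans.getD 7 []) = true := by
  decide +kernel
theorem run8 : run known (plans.getD 8 []) = true := by
  decide +kernel
theorem run9 : run known (plans.getD 9 []) = true := by
  decide +kernel
theorem run10 : run known (plans.getD 10 []) = true := by
  decide +kernel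
theorem run11 : run known (plans.getD 11 []) = true := by
  decide +kernel
theorem run12 : run known (plans.getD 12 []) = true := by
  decide +kernel
theorem run13 : run known (plans.getD 13 []) = true := by
  decide +kernel
theorem run14 : run known (plans.getD 14 []) = true := by
  decide +kernel
theorem run15 : run known (plans.getD 15 []) = true := by
  decide +kernel
theorem run16 : run known (plans.getD 16 []) = true := by
  decide +kernel
theorem run17 : run known (plans.getD 17 []) = true := by
  decide +kernel
theorem run18 : run known (plans.getD 18 []) = true := by
  decide +kernel
theorem run19 : run known (plans.getD 19 []) = true := by
  decide +kernel
theorem run20 : run known (plans.getD 20 []) = true := by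
  decide +kernel
theorem run21 : run known (plans.getD 21 []) = true := by
  decide +kernel
theorem run22 : run known (plans.getD 22 []) = true := by
  decide +kernel
theorem run23 : run known (plans.getD 23 []) = true := by
  decide +kernel
theorem run24 : run known (plans.getD 24 []) = true := by
  decide +kernel
theorem run25 : run known (plans.getD 25 []) = true := by
  decide +kernel
theorem run26 : run known (plans.getD 26 []) = true := by
  decide +kernel
theorem run27 : run known (plans.getD 27 []) = true := by
  decide +kernel
theorem run28 : run known (plans.getD 28 []) = true := by
  decide +kernel
theorem run29 : run known (plans.getD 29 []) = true := by
  decide +kernel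
theorem run30 : run known (plans.getD 30 []) = true := by
  decide +kernel
theorem run31 : run known (plans.getD 31 []) = true := by
  decide +kernel
theorem run32 : run known (plans.getD 32 []) = true := by
  decide +kernel
theorem run33 : run known (plans.getD 33 []) = true := by
  decide +kernel
theorem run34 : run known (plans.getD 34 []) = true := by
  decide +kernel
theorem run35 : run known (plans.getD 35 []) = true := by
  decide +kernel
theorem run36 : run known (plans.getD 36 []) = true := by
  decide +kernel

theorem run_all : ∀ pl ∈ plans, run known pl = true := by
  have h : ∀ n < 37, run known (plans.getD n []) = true := by
    intro n hn
    interval_cases n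
    · exact run0
    · exact run1
    · exact run2
    · exact run3
    · exact run4
    · exact run5
    · exact run6
    · exact run7
    · exact run8
    · exact run9
    · exact run10
    · exact run11
    · exact run12
    · exact run13
    · exact run14
    · exact run15
    · exact run16
    · exact run17
    · exact run18
    · exact run19
    · exact run20
    · exact run21
    · exact run22
    · exact run23
    · exact run24
    · exact run25
    · exact run26
    · exact run27
    · exact run28
    · exact run29
    · exact run30
    · exact run31
    · exact run32
    · exact run33
    · exact run34
    · exact run35
    · exact run36
  intro pl hpl
  obtain ⟨n, hn, rfl⟩ := List.mem_iff_getElem.1 hpl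
  have := h n hn
  rwa [List.getD_eq_getElem _ _ hn] at this


/-! ### Geometry -/

theorem adj_symm {a b : Cell} (h : Adj a b) : Adj b a := by
  unfold Adj at *; omega

theorem enclosed_ray {F : Set Cell} {c d : Cell} (hd : Adj (0, 0) d) (h : Enclosed F c) :
    ∃ n : ℕ, (c.1 + n * d.1, c.2 + n * d.2) ∈ F := by
  by_contra hcon
  push Not at hcon
  have hr : ∀ n : ℕ, ReachIn Fᶜ c (c.1 + n * d.1, c.2 + n * d.2) := by
    intro n
    induction n with
    | zero => simp only [Nat.cast_zero, zero_mul, add_zero]; exact Relation.ReflTransGen.refl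
    | succ n ih =>
      refine Relation.ReflTransGen.tail ih ⟨?_, hcon n, hcon (n + 1)⟩
      unfold Adj at *
      simp only at *
      push_cast
      have e1 : c.1 + n * d.1 - (c.1 + (n + 1) * d.1) = 0 - d.1 := by ring
      have e2 : c.2 + n * d.2 - (c.2 + (n + 1) * d.2) = 0 - d.2 := by ring
      rw [e1, e2]; exact hd
  refine Set.infinite_of_injective_forall_mem (f := fun n : ℕ =>
    ((c.1 + n * d.1, c.2 + n * d.2) : Cell)) ?_ hr h.2
  intro m n hmn
  simp only [Prod.mk.injEq, add_right_inj, mul_eq_mul_right_iff, Nat.cast_inj] at hmn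
  unfold Adj at hd
  simp only at hd
  rcases hmn with ⟨h1 | h1, h2 | h2⟩
  · exact h1
  · exact h1
  · exact h2
  · rw [h1, h2] at hd; simp at hd

/-- Relative position of an offset. -/
def dec (k : ℕ) : Cell := ((((k + 5) % 42 : ℕ) : ℤ) - 5, (((k + 5) / 42 : ℕ) : ℤ))

def Box (c : Cell) : Prop := -10 ≤ c.1 ∧ c.1 ≤ 10 ∧ -10 ≤ c.2 ∧ c.2 ≤ 10

/-- Code of a cell. -/
def enc (c : Cell) : ℕ := ((c.1 + 10) + 42 * (c.2 + 10)).toNat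

/-- Cell of a code. -/
def decB (n : ℕ) : Cell := (((n % 42 : ℕ) : ℤ) - 10, ((n / 42 : ℕ) : ℤ) - 10)

theorem dec_zero : dec 0 = (0, 0) := rfl

theorem enc_cast {c : Cell} (h : Box c) : (enc c : ℤ) = (c.1 + 10) + 42 * (c.2 + 10) := by
  unfold Box at h
  rw [enc, Int.toNat_of_nonneg]; omega

theorem enc_inj {c d : Cell} (hc : Box c) (hd : Box d) (h : enc c = enc d) : c = d := by
  have h1 := enc_cast hc
  have h2 := enc_cast hd
  rw [h, h2] at h1
  unfold Box at *
  ext <;> omega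

theorem decB_enc {c : Cell} (hc : Box c) : decB (enc c) = c := by
  have h1 := enc_cast hc
  unfold Box at hc
  unfold decB
  ext <;> simp only <;> omega

theorem enc_dec {a : Cell} (ha : Box a) {k : ℕ} (h : Box (a + dec k)) :
    enc (a + dec k) = enc a + k := by
  have h1 := enc_cast h
  have h2 := enc_cast ha
  have h3 : (dec k).1 + 42 * (dec k).2 = k := by unfold dec; simp only; omega
  simp only [Prod.fst_add, Prod.snd_add] at h1
  omega

theorem nadj_iff {c d : Cell} (hc : Box c) (hd : Box d) : NAdj (enc c) (enc d) ↔ Adj c d := by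
  have h1 := enc_cast hc
  have h2 := enc_cast hd
  unfold Box at *
  unfold NAdj Adj
  omega

/-- Cells of the tetrominoes as lists. -/
def tetsL : Fin 5 → List Cell :=
  ![[(0,0), (0,1), (0,2), (0,3)],
    [(0,0), (1,0), (0,1), (0,2)],
    [(0,0), (1,0), (1,1), (2,1)],
    [(0,0), (1,0), (0,1), (1,1)],
    [(0,0), (1,0), (2,0), (1,1)]]

theorem mem_tets (i : Fin 5) (c : Cell) : c ∈ tets i ↔ c ∈ tetsL i := by
  fin_cases i <;> simp [tets, tetsL]

theorem oris_complete : ∀ i : Fin 5, i ≠ 1 → ∀ f ∈ symms, ∃ o ∈ ori i.val,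
    ∃ a ∈ (tetsL i).map f, (∀ x ∈ (tetsL i).map f, x ∈ (off o).map (fun k => a + dec k)) ∧
      (∀ x ∈ (off o).map (fun k => a + dec k), x ∈ (tetsL i).map f) := by
  decide +kernel

theorem oris_complete1 : (∀ x ∈ tetsL 1, x ∈ (off ⟨1, 42, 84⟩).map dec) ∧
    (∀ x ∈ (off ⟨1, 42, 84⟩).map dec, x ∈ tetsL 1) := by
  decide +kernel

theorem placement_ori {i : Fin 5} (hi : i ≠ 1) {Q : Set Cell} (h : IsPlacement (tets i) Q) :
    ∃ o ∈ ori i.val, ∃ a : Cell, ∀ c, c ∈ Q ↔ ∃ k ∈ off o, c = a + dec k := by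
  obtain ⟨f, hf, t, rfl⟩ := h
  obtain ⟨o, ho, a, -, h1, h2⟩ := oris_complete i hi f hf
  refine ⟨o, ho, a + t, ?_⟩
  intro c
  constructor
  · rintro ⟨x, hx, rfl⟩
    obtain ⟨k, hk, e⟩ := List.mem_map.1 (h1 (f x) (List.mem_map_of_mem ((mem_tets i x).1 hx)))
    exact ⟨k, hk, by simp only [← e]; abel⟩
  · rintro ⟨k, hk, rfl⟩
    obtain ⟨x, hx, e⟩ := List.mem_map.1 (h2 _ (List.mem_map_of_mem hk))
    exact ⟨x, (mem_tets i x).2 hx, by simp only [e]; abel⟩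

theorem ori_span : ∀ t < 5, ∀ o ∈ ori t, ∀ k ∈ off o, ∀ l ∈ off o,
    (dec k).1 ≤ (dec l).1 + 3 ∧ (dec k).2 ≤ (dec l).2 + 3 := by
  decide +kernel

theorem adj2_bool (P : Fin 5 → Fin 5 → Prop) (g : ℕ → ℕ → Bool)
    (hg : ∀ i j : Fin 5, i ≠ j → (g i j = true ↔ P i j))
    (h : ∀ i, 2 ≤ Set.ncard {j | j ≠ i ∧ P i j}) : deg2 g = true := by
  classical
  rw [deg2, List.all_eq_true]
  intro n hn
  have hn5 : n < 5 := by simpa using hn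
  have h1 := h ⟨n, hn5⟩
  have e : {j | j ≠ (⟨n, hn5⟩ : Fin 5) ∧ P ⟨n, hn5⟩ j} ⊆
      ((Finset.univ.filter fun j : Fin 5 => g n j = true : Finset (Fin 5)) : Set (Fin 5)) := by
    rintro j ⟨h1, h2⟩
    simp only [Finset.coe_filter, Finset.mem_univ, true_and, Set.mem_ofPred_eq]
    exact (hg ⟨n, hn5⟩ j (Ne.symm h1)).2 h2
  have h2 := Set.ncard_le_ncard e (Finset.finite_toSet _)
  rw [Set.ncard_coe_finset, Finset.card_filter, Fin.sum_univ_five] at h2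
  have h3 := le_trans h1 h2
  have e0 : ∀ b : Bool, (if b = true then 1 else 0) = b.toNat := by decide
  simp only [e0] at h3
  rw [Nat.ble_eq]
  exact h3

theorem solution_pieces {l : List (ℕ × ℕ)} {t : ℕ} {c : O × ℕ}
    (h : maskL (codes l t) = maskC c) (n : ℕ) : n ∈ codes l t ↔ ∃ k ∈ off c.1, c.2 + k = n := by
  rw [← maskL_bit, h, maskC_bit]

/-- The set of cells of a piece of a solution. -/
def solSet (l : List (ℕ × ℕ)) (t : ℕ) : Set Cell := {c | c ∈ (codes l t).map decB}

theorem codes_ok : ∀ l ∈ sols, ∀ t < 5, ∀ n ∈ codes l t, enc (decB n) = n ∧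
    (-10 ≤ (decB n).1 ∧ (decB n).1 ≤ 10 ∧ -10 ≤ (decB n).2 ∧ (decB n).2 ≤ 10) := by
  decide +kernel

theorem norm_main (F : TetFence) (h1 : F.piece 1 = tets 1) :
    {c | Enclosed (⋃ i, F.piece i) c}.Finite ∧
    (F.area ≤ 8 ∨ (F.area ≤ 9 ∧ ∃ l ∈ sols, ∀ j : Fin 5, F.piece j = solSet l j.val)) := by
  classical
  -- orientations and anchors
  have hex : ∀ i : Fin 5, ∃ o ∈ ori i.val, ∃ a : Cell,
      (∀ c, c ∈ F.piece i ↔ ∃ k ∈ off o, c = a + dec k) ∧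
      (i = 1 → o = ⟨1, 42, 84⟩ ∧ a = (0, 0)) := by
    intro i
    by_cases hi : i = 1
    · subst hi
      refine ⟨⟨1, 42, 84⟩, List.mem_cons_self, (0, 0), ?_, fun _ => ⟨rfl, rfl⟩⟩
      intro c
      rw [h1, mem_tets]
      constructor
      · intro hc
        obtain ⟨k, hk, e⟩ := List.mem_map.1 (oris_complete1.1 c hc)
        exact ⟨k, hk, by rw [← e]; simp⟩
      · rintro ⟨k, hk, rfl⟩
        have := oris_complete1.2 _ (List.mem_map_of_mem hk)
        rw [show ((0, 0) : Cell) + dec k = dec k from by ext <;> simp]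
        exact this
    · obtain ⟨o, ho, a, h⟩ := placement_ori hi (F.placement i)
      exact ⟨o, ho, a, h, fun h => absurd h hi⟩
  choose o ho a hpc hL using hex
  have hzero : ∀ o : O, 0 ∈ off o := fun o => List.mem_cons_self
  have ha : ∀ i, a i ∈ F.piece i := fun i => (hpc i _).2 ⟨0, hzero _, by rw [dec_zero]; simp⟩
  have hspan : ∀ i, ∀ c ∈ F.piece i, ∀ d ∈ F.piece i, c.1 ≤ d.1 + 3 ∧ c.2 ≤ d.2 + 3 := by
    intro i c hc d hd
    obtain ⟨k, hk, rfl⟩ := (hpc i c).1 hc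
    obtain ⟨m, hm, rfl⟩ := (hpc i d).1 hd
    have := ori_span i.val i.isLt (o i) (ho i) k hk m hm
    simp only [Prod.fst_add, Prod.snd_add]
    omega
  -- the adjacency graph
  let P : Fin 5 → Fin 5 → Prop := fun i j => PieceAdj (F.piece i) (F.piece j)
  have hPs : ∀ i j, P i j → P j i := by
    rintro i j ⟨x, hx, y, hy, h⟩; exact ⟨y, hy, x, hx, adj_symm h⟩
  let g := gl (decide (P 0 1)) (decide (P 0 2)) (decide (P 0 3)) (decide (P 0 4))
    (decide (P 1 2)) (decide (P 1 3)) (decide (P 1 4)) (decide (P 2 3)) (decide (P 2 4))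
    (decide (P 3 4))
  have hg : ∀ i j : Fin 5, i ≠ j → (g i j = true ↔ P i j) := by
    intro i j hij
    have hs : ∀ i j, P i j ↔ P j i := fun i j => ⟨hPs i j, hPs j i⟩
    fin_cases i <;> fin_cases j <;>
      first
        | exact absurd rfl hij
        | exact decide_eq_true_iff
        | exact decide_eq_true_iff.trans (hs _ _)
  have hgd : ∀ i : Fin 5, g i i = false := by
    intro i; fin_cases i <;> rfl
  have hdeg := adj2_bool P g hg F.adj2
  have hcov := cover (decide (P 0 1)) (decide (P 0 2)) (decide (P 0 3)) (decide (P 0 4))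
    (decide (P 1 2)) (decide (P 1 3)) (decide (P 1 4)) (decide (P 2 3)) (decide (P 2 4))
    (decide (P 3 4))
  change (!deg2 g || (near1 g && plans.any fun pl => satB g 0 ((1, []) :: pl))) = true at hcov
  rw [hdeg, Bool.not_true, Bool.false_or, Bool.and_eq_true] at hcov
  obtain ⟨hnear, hplan⟩ := hcov
  -- all cells lie in the box
  have hstep : ∀ i j, P i j → ∀ c ∈ F.piece j, ∃ d ∈ F.piece i,
      c.1 ≤ d.1 + 4 ∧ d.1 ≤ c.1 + 4 ∧ c.2 ≤ d.2 + 4 ∧ d.2 ≤ c.2 + 4 := by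
    rintro i j ⟨x, hx, y, hy, h⟩ c hc
    have s1 := hspan j c hc y hy
    have s2 := hspan j y hy c hc
    unfold Adj at h
    exact ⟨x, hx, by omega⟩
  have hbox1 : ∀ c ∈ F.piece 1, 0 ≤ c.1 ∧ c.1 ≤ 1 ∧ 0 ≤ c.2 ∧ c.2 ≤ 2 := by
    intro c hc
    rw [h1, mem_tets] at hc
    revert c
    show ∀ c ∈ tetsL 1, 0 ≤ c.1 ∧ c.1 ≤ 1 ∧ 0 ≤ c.2 ∧ c.2 ≤ 2
    decide
  have hgP : ∀ i j : Fin 5, g i j = true → P i j := by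
    intro i j h
    by_cases hij : i = j
    · subst hij; rw [hgd] at h; simp at h
    · exact (hg i j hij).1 h
  have hbox : ∀ i, ∀ c ∈ F.piece i, Box c := by
    intro i c hc
    unfold Box
    rw [near1, List.all_eq_true] at hnear
    have := hnear i.val (by simp)
    simp only [Bool.or_eq_true, beq_iff_eq, List.any_eq_true, Bool.and_eq_true,
      List.mem_range] at this
    rcases this with (h | h) | ⟨j, hj, h, h'⟩
    · have : i = 1 := Fin.ext h
      subst this
      have := hbox1 c hc
      omega
    · obtain ⟨d, hd, hh⟩ := hstep 1 i (hgP 1 i h) c hc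
      have := hbox1 d hd
      omega
    · obtain ⟨d, hd, hh⟩ := hstep ⟨j, hj⟩ i (hgP ⟨j, hj⟩ i h') c hc
      obtain ⟨e, he, hh'⟩ := hstep 1 ⟨j, hj⟩ (hgP 1 ⟨j, hj⟩ h) d hd
      have := hbox1 e he
      omega
  -- the configuration
  let cfg : ℕ → O × ℕ := fun n => if h : n < 5 then (o ⟨n, h⟩, enc (a ⟨n, h⟩)) else
    (o 0, enc (a 0))
  have hcfg : ∀ i : Fin 5, cfg i.val = (o i, enc (a i)) := by
    intro i; simp only [cfg, i.isLt, dif_pos]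
  have hcfg' : ∀ n, ∃ i : Fin 5, cfg n = (o i, enc (a i)) := by
    intro n
    by_cases h : n < 5
    · exact ⟨⟨n, h⟩, by simp only [cfg, h, dif_pos]⟩
    · exact ⟨0, by simp only [cfg, h]; rfl⟩
  have hcell : ∀ i : Fin 5, ∀ n, (∃ k ∈ off (cfg i.val).1, (cfg i.val).2 + k = n) ↔
      ∃ c ∈ F.piece i, enc c = n := by
    intro i n
    rw [hcfg]
    constructor
    · rintro ⟨k, hk, e⟩
      have hm := (hpc i (a i + dec k)).2 ⟨k, hk, rfl⟩
      exact ⟨_, hm, by rw [enc_dec (hbox i _ (ha i)) (hbox i _ hm)]; exact e⟩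
    · rintro ⟨c, hc, e⟩
      obtain ⟨k, hk, rfl⟩ := (hpc i c).1 hc
      exact ⟨k, hk, by rw [enc_dec (hbox i _ (ha i)) (hbox i _ hc)] at e; exact e⟩
  have hOv : ∀ i < 5, ∀ j < 5, i ≠ j → ¬ Ov (cfg i) (cfg j) := by
    rintro i hi j hj hij ⟨k, hk, m, hm, e⟩
    obtain ⟨c, hc, e1⟩ := (hcell ⟨i, hi⟩ _).1 ⟨k, hk, rfl⟩
    obtain ⟨d, hd, e2⟩ := (hcell ⟨j, hj⟩ _).1 ⟨m, hm, rfl⟩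
    dsimp only at e1 e2
    have : c = d := enc_inj (hbox _ _ hc) (hbox _ _ hd) (by rw [e1, e2, e])
    subst this
    exact Set.disjoint_left.1 (F.disj (i := ⟨i, hi⟩) (j := ⟨j, hj⟩)
      (fun h => hij (by simpa using h))) hc hd
  have hAd : ∀ i < 5, ∀ j < 5, i ≠ j → (g i j = true ↔ AdN (cfg i) (cfg j)) := by
    intro i hi j hj hij
    rw [hg ⟨i, hi⟩ ⟨j, hj⟩ (fun h => hij (by simpa using h))]
    constructor
    · rintro ⟨x, hx, y, hy, h⟩
      obtain ⟨k, hk, e1⟩ := (hcell ⟨i, hi⟩ _).2 ⟨x, hx, rfl⟩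
      obtain ⟨m, hm, e2⟩ := (hcell ⟨j, hj⟩ _).2 ⟨y, hy, rfl⟩
      refine ⟨k, hk, m, hm, ?_⟩
      dsimp only at e1 e2
      rw [e1, e2]
      exact (nadj_iff (hbox _ _ hx) (hbox _ _ hy)).2 h
    · rintro ⟨k, hk, m, hm, e⟩
      obtain ⟨c, hc, e1⟩ := (hcell ⟨i, hi⟩ _).1 ⟨k, hk, rfl⟩
      obtain ⟨d, hd, e2⟩ := (hcell ⟨j, hj⟩ _).1 ⟨m, hm, rfl⟩
      dsimp only at e1 e2
      rw [← e1, ← e2, nadj_iff (hbox _ _ hc) (hbox _ _ hd)] at e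
      exact ⟨c, hc, d, hd, e⟩
  obtain ⟨pl, hpl, hsat⟩ := List.any_eq_true.1 hplan
  have hsatR := satB_sound hOv hAd _ _ hsat
  have hpok := plans_ok pl hpl
  have hleaf : LeafOK known cfg := by
    refine run_sound (run_all pl hpl) hpok.1 hpok.2.1 hpok.2.2 ?_ ?_ ?_ ?_ hsatR
    · intro n
      obtain ⟨i, hi⟩ := hcfg' n
      rw [hi]
      exact ori_small i.val i.isLt (o i) (ho i)
    · intro n
      obtain ⟨i, hi⟩ := hcfg' n
      rw [hi]
      have hb := hbox i _ (ha i)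
      have h2 := enc_cast hb
      unfold Box at hb
      dsimp only
      omega
    · intro n hn
      rw [show cfg n = _ from hcfg ⟨n, hn⟩]
      exact ho ⟨n, hn⟩
    · rw [show cfg 1 = _ from hcfg 1, (hL 1 rfl).1, (hL 1 rfl).2]; rfl
  -- enclosed cells
  set U : Set Cell := ⋃ i, F.piece i with hU
  have hUm : ∀ c, c ∈ U → ∃ i : Fin 5, c ∈ F.piece i := fun c hc => Set.mem_iUnion.1 hc
  have hUbox : ∀ c ∈ U, Box c := by
    intro c hc; obtain ⟨i, hi⟩ := hUm c hc; exact hbox i c hi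
  have hEnc : ∀ c, Enclosed U c → Box c ∧ Sh cfg (enc c) := by
    intro c hc
    obtain ⟨n1, u1⟩ := enclosed_ray (d := (-1, 0)) (by unfold Adj; rfl) hc
    obtain ⟨n2, u2⟩ := enclosed_ray (d := (1, 0)) (by unfold Adj; rfl) hc
    obtain ⟨n3, u3⟩ := enclosed_ray (d := (0, -1)) (by unfold Adj; rfl) hc
    obtain ⟨n4, u4⟩ := enclosed_ray (d := (0, 1)) (by unfold Adj; rfl) hc
    have b1 := hUbox _ u1
    have b2 := hUbox _ u2
    have b3 := hUbox _ u3
    have b4 := hUbox _ u4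
    have c1 := enc_cast b1
    have c2 := enc_cast b2
    have c3 := enc_cast b3
    have c4 := enc_cast b4
    have hb : Box c := by
      unfold Box at b1 b2 b3 b4 ⊢
      simp only at b1 b2 b3 b4
      omega
    have c0 := enc_cast hb
    have key : ∀ d, d ∈ U → ∃ i < 5, ∃ k ∈ off (cfg i).1, (cfg i).2 + k = enc d := by
      intro d hd
      obtain ⟨i, hi⟩ := hUm d hd
      obtain ⟨k, hk, e⟩ := (hcell i _).2 ⟨d, hi, rfl⟩
      exact ⟨i.val, i.isLt, k, hk, e⟩
    refine ⟨hb, ?_, ?_, ?_, ?_, ?_⟩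
    · obtain ⟨i, hi, k, hk, e⟩ := key _ u1
      unfold Box at b1 hb
      simp only at b1 c1 e
      exact ⟨i, hi, k, hk, n1, by omega, by omega⟩
    · obtain ⟨i, hi, k, hk, e⟩ := key _ u2
      unfold Box at b2 hb
      simp only at b2 c2 e
      exact ⟨i, hi, k, hk, n2, by omega, by omega⟩
    · obtain ⟨i, hi, k, hk, e⟩ := key _ u3
      unfold Box at b3 hb
      simp only at b3 c3 e
      exact ⟨i, hi, k, hk, n3, by omega, by omega⟩
    · obtain ⟨i, hi, k, hk, e⟩ := key _ u4
      unfold Box at b4 hb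
      simp only at b4 c4 e
      exact ⟨i, hi, k, hk, n4, by omega, by omega⟩
    · intro i hi k hk e
      obtain ⟨d, hd, e1⟩ := (hcell ⟨i, hi⟩ _).1 ⟨k, hk, e⟩
      have : d = c := enc_inj (hbox _ _ hd) hb e1
      subst this
      exact hc.1 (Set.mem_iUnion.2 ⟨_, hd⟩)
  have hfin : {c | Enclosed U c}.Finite := by
    refine Set.Finite.subset (Set.finite_Icc ((-10, -10) : Cell) (10, 10)) ?_
    intro c hc
    have hb := (hEnc c hc).1
    unfold Box at hb
    exact ⟨⟨hb.1, hb.2.2.1⟩, ⟨hb.2.1, hb.2.2.2⟩⟩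
  have harea : ∀ n, (∀ A : Finset ℕ, (∀ e ∈ A, Sh cfg e) → A.card ≤ n) → F.area ≤ n := by
    intro n h
    have h2 := h (hfin.toFinset.image enc) (by
      intro e he
      obtain ⟨c, hc, rfl⟩ := Finset.mem_image.1 he
      exact (hEnc c ((Set.Finite.mem_toFinset hfin).1 hc)).2)
    rw [Finset.card_image_of_injOn] at h2
    · rw [TetFence.area, encArea, Set.ncard_eq_toFinset_card _ hfin]
      exact h2
    · intro c hc d hd e
      have hc' := (Set.Finite.mem_toFinset hfin).1 (Finset.mem_coe.1 hc)
      have hd' := (Set.Finite.mem_toFinset hfin).1 (Finset.mem_coe.1 hd)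
      exact enc_inj (hEnc c hc').1 (hEnc d hd').1 e
  refine ⟨hfin, ?_⟩
  rcases hleaf with h | ⟨h, K, hK, hm⟩
  · exact Or.inl (harea 8 h)
  · refine Or.inr ⟨harea 9 h, ?_⟩
    obtain ⟨l, hl, rfl⟩ := List.mem_map.1 hK
    refine ⟨l, hl, ?_⟩
    intro j
    have hmj : maskL (codes l j.val) = maskC (cfg j.val) := by
      have := hm j.val j.isLt
      rw [← this]
      fin_cases j <;> rfl
    have hco := solution_pieces hmj
    ext c
    show _ ↔ c ∈ (codes l j.val).map decB
    rw [List.mem_map]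
    constructor
    · intro hc
      exact ⟨enc c, (hco _).2 ((hcell j _).2 ⟨c, hc, rfl⟩), decB_enc (hbox j c hc)⟩
    · rintro ⟨n, hn, rfl⟩
      obtain ⟨d, hd, e⟩ := (hcell j _).1 ((hco n).1 hn)
      rw [← e, decB_enc (hbox j d hd)]
      exact hd

/-! ### Isometries -/

theorem symm_lin : ∀ f ∈ symms, ∀ c : Cell, f c =
    (c.1 * (f (1, 0)).1 + c.2 * (f (0, 1)).1, c.1 * (f (1, 0)).2 + c.2 * (f (0, 1)).2) := by
  intro f hf c
  simp only [symms, List.mem_cons, List.not_mem_nil, or_false] at hf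
  rcases hf with rfl | rfl | rfl | rfl | rfl | rfl | rfl | rfl <;> simp

theorem symm_add {f : Cell → Cell} (hf : f ∈ symms) (a b : Cell) : f (a + b) = f a + f b := by
  rw [symm_lin f hf (a + b), symm_lin f hf a, symm_lin f hf b]
  ext <;> simp only [Prod.fst_add, Prod.snd_add] <;> ring

theorem symm_adj {f : Cell → Cell} (hf : f ∈ symms) (a b : Cell) : Adj (f a) (f b) ↔ Adj a b := by
  unfold Adj
  simp only [symms, List.mem_cons, List.not_mem_nil, or_false] at hf
  rcases hf with rfl | rfl | rfl | rfl | rfl | rfl | rfl | rfl <;> simp only <;> omega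

theorem comp_table : ∀ f ∈ symms, ∀ g ∈ symms, ∃ h ∈ symms,
    h (1, 0) = g (f (1, 0)) ∧ h (0, 1) = g (f (0, 1)) := by
  decide +kernel

theorem inv_table : ∀ f ∈ symms, ∃ g ∈ symms,
    g (f (1, 0)) = (1, 0) ∧ g (f (0, 1)) = (0, 1) ∧
    f (g (1, 0)) = (1, 0) ∧ f (g (0, 1)) = (0, 1) := by
  decide +kernel

theorem symm_lin2 {f g : Cell → Cell} (hf : f ∈ symms) (hg : g ∈ symms) (c : Cell) : g (f c) =
    (c.1 * (g (f (1, 0))).1 + c.2 * (g (f (0, 1))).1,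
      c.1 * (g (f (1, 0))).2 + c.2 * (g (f (0, 1))).2) := by
  rw [symm_lin g hg (f c), symm_lin f hf c, symm_lin g hg (f (1, 0)), symm_lin g hg (f (0, 1))]
  ext <;> simp only <;> ring

theorem symm_comp {f g : Cell → Cell} (hf : f ∈ symms) (hg : g ∈ symms) :
    ∃ h ∈ symms, ∀ c, h c = g (f c) := by
  obtain ⟨h, hh, e1, e2⟩ := comp_table f hf g hg
  exact ⟨h, hh, fun c => by rw [symm_lin2 hf hg, symm_lin h hh, e1, e2]⟩

theorem symm_inv {f : Cell → Cell} (hf : f ∈ symms) :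
    ∃ g ∈ symms, (∀ c, g (f c) = c) ∧ ∀ c, f (g c) = c := by
  obtain ⟨g, hg, e1, e2, e3, e4⟩ := inv_table f hf
  refine ⟨g, hg, fun c => ?_, fun c => ?_⟩
  · rw [symm_lin2 hf hg, e1, e2]; ext <;> simp
  · rw [symm_lin2 hg hf, e3, e4]; ext <;> simp

theorem iso_equiv {f : Cell → Cell} (hf : f ∈ symms) (t : Cell) :
    ∃ e : Cell ≃ Cell, (⇑e = fun c => f c + t) ∧ ∀ a b, Adj (e a) (e b) ↔ Adj a b := by
  obtain ⟨g, hg, h1, h2⟩ := symm_inv hf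
  refine ⟨⟨fun c => f c + t, fun c => g (c - t), fun c => ?_, fun c => ?_⟩, rfl, fun a b => ?_⟩
  · simp [h1]
  · simp [h2]
  · rw [← symm_adj hf a b]
    show Adj (f a + t) (f b + t) ↔ _
    unfold Adj
    simp

theorem reach_image (e : Cell ≃ Cell) (he : ∀ a b, Adj (e a) (e b) ↔ Adj a b) {S : Set Cell}
    {p q : Cell} (h : ReachIn S p q) : ReachIn (e '' S) (e p) (e q) := by
  induction h with
  | refl => exact Relation.ReflTransGen.refl
  | tail _ h ih =>
    exact Relation.ReflTransGen.tail ih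
      ⟨(he _ _).2 h.1, Set.mem_image_of_mem e h.2.1, Set.mem_image_of_mem e h.2.2⟩

theorem reach_iff (e : Cell ≃ Cell) (he : ∀ a b, Adj (e a) (e b) ↔ Adj a b) {S : Set Cell}
    {p q : Cell} : ReachIn (e '' S) (e p) (e q) ↔ ReachIn S p q := by
  refine ⟨fun h => ?_, reach_image e he⟩
  have := reach_image e.symm (fun a b => by rw [← he]; simp) h
  simpa using this

theorem enclosed_iff (e : Cell ≃ Cell) (he : ∀ a b, Adj (e a) (e b) ↔ Adj a b) {S : Set Cell}
    {c : Cell} : Enclosed (e '' S) (e c) ↔ Enclosed S c := by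
  have h : component (e '' S)ᶜ (e c) = e '' component Sᶜ c := by
    ext d
    obtain ⟨d, rfl⟩ := e.surjective d
    rw [← Set.image_compl_eq e.bijective, e.injective.mem_set_image]
    exact reach_iff e he
  unfold Enclosed
  rw [h, e.injective.mem_set_image, Set.finite_image_iff e.injective.injOn]

theorem encSet_image (e : Cell ≃ Cell) (he : ∀ a b, Adj (e a) (e b) ↔ Adj a b) (S : Set Cell) :
    {c | Enclosed (e '' S) c} = e '' {c | Enclosed S c} := by
  ext d
  obtain ⟨d, rfl⟩ := e.surjective d
  rw [e.injective.mem_set_image]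
  exact enclosed_iff e he

theorem encArea_image (e : Cell ≃ Cell) (he : ∀ a b, Adj (e a) (e b) ↔ Adj a b) (S : Set Cell) :
    encArea (e '' S) = encArea S := by
  unfold encArea
  rw [encSet_image e he, Set.ncard_image_of_injective _ e.injective]

theorem pieceAdj_image (e : Cell ≃ Cell) (he : ∀ a b, Adj (e a) (e b) ↔ Adj a b) (A B : Set Cell) :
    PieceAdj (e '' A) (e '' B) ↔ PieceAdj A B := by
  constructor
  · rintro ⟨_, ⟨a, ha, rfl⟩, _, ⟨b, hb, rfl⟩, h⟩
    exact ⟨a, ha, b, hb, (he a b).1 h⟩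
  · rintro ⟨a, ha, b, hb, h⟩
    exact ⟨e a, ⟨a, ha, rfl⟩, e b, ⟨b, hb, rfl⟩, (he a b).2 h⟩

theorem iso_comp {f g : Cell → Cell} (hf : f ∈ symms) (hg : g ∈ symms) (s t : Cell) :
    ∃ h ∈ symms, ∃ u, ∀ S : Set Cell,
      (fun c => g c + t) '' ((fun c => f c + s) '' S) = (fun c => h c + u) '' S := by
  obtain ⟨h, hh, e⟩ := symm_comp hf hg
  refine ⟨h, hh, g s + t, fun S => ?_⟩
  rw [Set.image_image]
  refine Set.image_congr fun c _ => ?_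
  rw [symm_add hg, e, add_assoc]

theorem move_exists (F : TetFence) {f : Cell → Cell} (hf : f ∈ symms) (t : Cell) :
    ∃ G : TetFence, ∀ i, G.piece i = (fun c => f c + t) '' F.piece i := by
  obtain ⟨e, e1, he⟩ := iso_equiv hf t
  rw [← e1]
  refine ⟨⟨fun i => e '' F.piece i, fun i => ?_, fun i j hij => ?_, ?_, fun i => ?_⟩, fun i => rfl⟩
  · obtain ⟨g, hg, s, h⟩ := F.placement i
    obtain ⟨h', hh, u, e2⟩ := iso_comp hg hf s t
    exact ⟨h', hh, u, by rw [h, e1, e2]⟩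
  · exact (Set.disjoint_image_iff e.injective).2 (F.disj hij)
  · rw [← Set.image_iUnion]
    rintro _ ⟨p, hp, rfl⟩ _ ⟨q, hq, rfl⟩
    exact reach_image e he (F.conn p hp q hq)
  · simp only [pieceAdj_image e he]
    exact F.adj2 i

theorem encSet_equiv {F G : TetFence} (h : TetFenceEquiv F G) : ∃ e : Cell ≃ Cell,
    {c | Enclosed (⋃ i, G.piece i) c} = e '' {c | Enclosed (⋃ i, F.piece i) c} := by
  obtain ⟨f, hf, t, h⟩ := h
  obtain ⟨e, e1, he⟩ := iso_equiv hf t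
  refine ⟨e, ?_⟩
  rw [← encSet_image e he, Set.image_iUnion]
  simp only [h, e1]

theorem area_equiv {F G : TetFence} (h : TetFenceEquiv F G) : G.area = F.area := by
  obtain ⟨e, he⟩ := encSet_equiv h
  unfold TetFence.area encArea
  rw [he, Set.ncard_image_of_injective _ e.injective]

theorem equiv_refl (F : TetFence) : TetFenceEquiv F F := by
  refine ⟨fun p => (p.1, p.2), List.mem_cons_self, 0, fun i => ?_⟩
  simp

theorem equiv_trans {F G H : TetFence} (h1 : TetFenceEquiv F G) (h2 : TetFenceEquiv G H) :
    TetFenceEquiv F H := by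
  obtain ⟨f, hf, s, h1⟩ := h1
  obtain ⟨g, hg, t, h2⟩ := h2
  obtain ⟨h, hh, u, e⟩ := iso_comp hf hg s t
  exact ⟨h, hh, u, fun i => by rw [h2, h1, e]⟩

theorem iso_inv {f : Cell → Cell} (hf : f ∈ symms) (t : Cell) :
    ∃ g ∈ symms, ∃ s, ∀ S : Set Cell, (fun c => g c + s) '' ((fun c => f c + t) '' S) = S := by
  obtain ⟨g, hg, h1, -⟩ := symm_inv hf
  refine ⟨g, hg, - g t, fun S => ?_⟩
  rw [Set.image_image]
  have : (fun c => g (f c + t) + - g t) = id := by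
    funext c
    rw [symm_add hg, h1]; simp
  rw [this, Set.image_id]

theorem equiv_symm {F G : TetFence} (h : TetFenceEquiv F G) : TetFenceEquiv G F := by
  obtain ⟨f, hf, s, h⟩ := h
  obtain ⟨g, hg, t, e⟩ := iso_inv hf s
  exact ⟨g, hg, t, fun i => by rw [h, e]⟩

/-- Every fence is equivalent to one in which the L tetromino is in standard position. -/
theorem normalize (F : TetFence) : ∃ G : TetFence, TetFenceEquiv F G ∧ G.piece 1 = tets 1 := by
  obtain ⟨f, hf, s, h⟩ := F.placement 1
  obtain ⟨g, hg, t, e⟩ := iso_inv hf s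
  obtain ⟨G, hG⟩ := move_exists F hg t
  exact ⟨G, ⟨g, hg, t, hG⟩, by rw [hG, h, e]⟩

theorem area_le (F : TetFence) : F.area ≤ 9 := by
  obtain ⟨G, hG, h1⟩ := normalize F
  rw [← area_equiv hG]
  rcases (norm_main G h1).2 with h | h
  · omega
  · exact h.1

theorem enc_finite (F : TetFence) : {c | Enclosed (⋃ i, F.piece i) c}.Finite := by
  obtain ⟨G, hG, h1⟩ := normalize F
  obtain ⟨e, he⟩ := encSet_equiv (equiv_symm hG)
  rw [he]
  exact (norm_main G h1).1.image e

/-! ### The 21 fences -/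

instance adjDec : DecidableRel Adj := fun _ _ => inferInstanceAs (Decidable (_ = _))

/-- Cells of piece `t` of a solution. -/
def cl (l : List (ℕ × ℕ)) (t : ℕ) : List Cell := (codes l t).map decB

/-- All cells of a solution. -/
def allc (l : List (ℕ × ℕ)) : List Cell := l.map fun p => decB p.1

/-- The neighbours of a cell. -/
def nb (c : Cell) : List Cell :=
  [(c.1 + 1, c.2), (c.1 - 1, c.2), (c.1, c.2 + 1), (c.1, c.2 - 1)]

theorem mem_nb {c d : Cell} (h : Adj c d) : d ∈ nb c := by
  unfold Adj at h
  simp only [nb, List.mem_cons, List.not_mem_nil, or_false, Prod.ext_iff]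
  omega

/-- Every cell of the second list is adjacent to an earlier one. -/
def chainB : List Cell → List Cell → Bool
  | _, [] => true
  | acc, x :: r => (acc.any fun a => decide (Adj a x)) && chainB (x :: acc) r

theorem chain_sound {U : Set Cell} {p : Cell} : ∀ (r acc : List Cell), chainB acc r = true →
    (∀ x ∈ acc, x ∈ U ∧ ReachIn U p x) → (∀ x ∈ r, x ∈ U) → ∀ x ∈ r, ReachIn U p x := by
  intro r
  induction r with
  | nil => intro _ _ _ _ x hx; simp at hx
  | cons y r ih =>
    intro acc h h1 h2
    rw [chainB, Bool.and_eq_true, List.any_eq_true] at h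
    obtain ⟨⟨a, ha, hay⟩, h⟩ := h
    have hy : ReachIn U p y := Relation.ReflTransGen.tail (h1 a ha).2
      ⟨of_decide_eq_true hay, (h1 a ha).1, h2 y List.mem_cons_self⟩
    have h3 := ih (y :: acc) h (by
      intro x hx
      rcases List.mem_cons.1 hx with rfl | hx
      · exact ⟨h2 x List.mem_cons_self, hy⟩
      · exact h1 x hx) (fun x hx => h2 x (List.mem_cons_of_mem _ hx))
    intro x hx
    rcases List.mem_cons.1 hx with rfl | hx
    · exact hy
    · exact h3 x hx

theorem reach_symm {U : Set Cell} {p q : Cell} (h : ReachIn U p q) : ReachIn U q p := by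
  induction h with
  | refl => exact Relation.ReflTransGen.refl
  | tail _ h ih => exact Relation.ReflTransGen.head ⟨adj_symm h.1, h.2.2, h.2.1⟩ ih

theorem sol_place : ∀ l ∈ sols, ∀ i : Fin 5, ∃ f ∈ symms, ∃ a ∈ cl l i,
    (∀ x ∈ tetsL i, f x + a ∈ cl l i) ∧ ∀ x ∈ cl l i, x ∈ (tetsL i).map (fun c => f c + a) := by
  decide +kernel

theorem sol_disj : ∀ l ∈ sols, ∀ i j : Fin 5, i ≠ j → ∀ x ∈ cl l i, x ∉ cl l j := by
  decide +kernel

theorem sol_all : ∀ l ∈ sols, (∀ x ∈ allc l, ∃ i : Fin 5, x ∈ cl l i) ∧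
    (∀ i : Fin 5, ∀ x ∈ cl l i, x ∈ allc l) ∧ (0, 0) ∈ allc l ∧
    chainB [(0, 0)] ((allc l).tail) = true ∧ (allc l).head? = some (0, 0) := by
  decide +kernel

theorem sol_adj : ∀ l ∈ sols, ∀ i : Fin 5, ∃ j k : Fin 5, j ≠ k ∧
    (j ≠ i ∧ ∃ a ∈ cl l i, ∃ b ∈ cl l j, Adj a b) ∧
    (k ≠ i ∧ ∃ a ∈ cl l i, ∃ b ∈ cl l k, Adj a b) := by
  decide +kernel

theorem sol_encl : ∀ l ∈ sols, ∃ D ∈ encl, (D.map decB).Nodup ∧ D.length = 9 ∧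
    ∀ x ∈ D.map decB, x ∉ allc l ∧ ∀ y ∈ nb x, y ∈ D.map decB ∨ y ∈ allc l := by
  decide +kernel

theorem sol_std : ∀ l ∈ sols, (∀ x ∈ tetsL 1, x ∈ cl l 1) ∧ ∀ x ∈ cl l 1, x ∈ tetsL 1 := by
  decide +kernel

theorem sol_length : sols.length = 21 := by decide +kernel

theorem sol_ne : ∀ i j : Fin 21, (∀ t : Fin 5, ∀ x ∈ cl (sols.getD i []) t,
    x ∈ cl (sols.getD j []) t) → i = j := by
  decide +kernel

theorem stab : ∀ f ∈ symms, ∀ a ∈ tetsL 1, (∀ x ∈ tetsL 1, f x + a ∈ tetsL 1) →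
    a = (0, 0) ∧ f (1, 0) = (1, 0) ∧ f (0, 1) = (0, 1) := by
  decide +kernel

theorem sol_union {l : List (ℕ × ℕ)} (hl : l ∈ sols) (x : Cell) :
    (x ∈ ⋃ i : Fin 5, solSet l i.val) ↔ x ∈ allc l := by
  rw [Set.mem_iUnion]
  constructor
  · rintro ⟨i, hi⟩
    exact (sol_all l hl).2.1 i x hi
  · intro h
    exact (sol_all l hl).1 x h

theorem sol_fence {l : List (ℕ × ℕ)} (hl : l ∈ sols) :
    ∃ F : TetFence, F.area = 9 ∧ ∀ i : Fin 5, F.piece i = solSet l i.val := by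
  have hF : ∃ F : TetFence, ∀ i : Fin 5, F.piece i = solSet l i.val := by
    refine ⟨⟨fun i => solSet l i.val, fun i => ?_, fun i j hij => ?_, ?_, fun i => ?_⟩,
      fun i => rfl⟩
    · obtain ⟨f, hf, a, -, h1, h2⟩ := sol_place l hl i
      refine ⟨f, hf, a, ?_⟩
      ext x
      constructor
      · intro hx
        obtain ⟨c, hc, e⟩ := List.mem_map.1 (h2 x hx)
        exact ⟨c, (mem_tets i c).2 hc, e⟩
      · rintro ⟨c, hc, rfl⟩
        exact h1 c ((mem_tets i c).1 hc)
    · exact Set.disjoint_left.2 fun x hx hx' => sol_disj l hl i j hij x hx hx'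
    · obtain ⟨-, -, h0, hc, hh⟩ := sol_all l hl
      have key : ∀ x ∈ ⋃ i : Fin 5, solSet l i.val,
          ReachIn (⋃ i : Fin 5, solSet l i.val) (0, 0) x := by
        intro x hx
        have hx' := (sol_union hl x).1 hx
        rw [← List.cons_head?_tail hh] at hx'
        rcases List.mem_cons.1 hx' with rfl | hx'
        · exact Relation.ReflTransGen.refl
        · refine chain_sound _ _ hc ?_ ?_ x hx'
          · intro y hy
            rw [List.mem_singleton] at hy
            subst hy
            exact ⟨(sol_union hl _).2 h0, Relation.ReflTransGen.refl⟩
          · intro y hy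
            exact (sol_union hl y).2 (List.mem_of_mem_tail hy)
      intro p hp q hq
      exact (reach_symm (key p hp)).trans (key q hq)
    · obtain ⟨j, k, hjk, hj, hk⟩ := sol_adj l hl i
      rw [← Set.ncard_pair hjk]
      refine Set.ncard_le_ncard ?_ (Set.toFinite _)
      rintro m (rfl | rfl)
      · exact hj
      · exact hk
  obtain ⟨F, hF⟩ := hF
  refine ⟨F, le_antisymm (area_le F) ?_, hF⟩
  obtain ⟨D, -, hnd, hlen, hD⟩ := sol_encl l hl
  have hU : ∀ x, (x ∈ ⋃ i, F.piece i) ↔ x ∈ allc l := by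
    intro x
    rw [← sol_union hl]
    simp only [hF]
  have hsub : ((D.map decB).toFinset : Set Cell) ⊆ {c | Enclosed (⋃ i, F.piece i) c} := by
    intro x hx
    have hx : x ∈ D.map decB := List.mem_toFinset.1 (Finset.mem_coe.1 hx)
    refine ⟨fun h => (hD x hx).1 ((hU x).1 h), ?_⟩
    refine Set.Finite.subset (Finset.finite_toSet (D.map decB).toFinset) ?_
    intro y hy
    refine Finset.mem_coe.2 (List.mem_toFinset.2 ?_)
    change ReachIn (⋃ i, F.piece i)ᶜ x y at hy
    induction hy with
    | refl => exact hx
    | tail _ h ih =>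
      rcases (hD _ ih).2 _ (mem_nb h.1) with h' | h'
      · exact h'
      · exact absurd ((hU _).2 h') h.2.2
  have h9 : (D.map decB).toFinset.card = 9 := by
    rw [List.toFinset_card_of_nodup hnd, List.length_map, hlen]
  rw [← h9, ← Set.ncard_coe_finset]
  exact Set.ncard_le_ncard hsub (enc_finite F)

theorem std_rigid {F G : TetFence} (hF : F.piece 1 = tets 1) (hG : G.piece 1 = tets 1)
    (h : TetFenceEquiv F G) : ∀ i, G.piece i = F.piece i := by
  obtain ⟨f, hf, t, h⟩ := h
  have h1 := h 1
  rw [hF, hG] at h1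
  have hm : ∀ x ∈ tetsL 1, f x + t ∈ tetsL 1 := by
    intro x hx
    rw [← mem_tets, h1]
    exact ⟨x, (mem_tets 1 x).2 hx, rfl⟩
  have ht : t ∈ tetsL 1 := by
    have := hm (0, 0) List.mem_cons_self
    rw [symm_lin f hf] at this
    simp only [zero_mul, add_zero] at this
    rwa [show ((0, 0) : Cell) + t = t from by ext <;> simp] at this
  obtain ⟨e, e1, e2⟩ := stab f hf t ht hm
  intro i
  rw [h i]
  have : (fun c => f c + t) = id := by
    funext c
    rw [symm_lin f hf, e, e1, e2]
    ext <;> simp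
  rw [this, Set.image_id]

theorem solSet_one {l : List (ℕ × ℕ)} (hl : l ∈ sols) : solSet l 1 = tets 1 := by
  ext x
  rw [mem_tets]
  exact ⟨(sol_std l hl).2 x, (sol_std l hl).1 x⟩

theorem count21 : Nat.card (Quot fun (F G : {F : TetFence // F.area = 9}) =>
    TetFenceEquiv F.1 G.1) = 21 := by
  have hmem : ∀ i : Fin 21, sols.getD i [] ∈ sols := by
    intro i
    have hi : i.val < sols.length := by rw [sol_length]; exact i.isLt
    rw [List.getD_eq_getElem _ _ hi]
    exact List.getElem_mem hi
  choose S hS9 hSp using fun i : Fin 21 => sol_fence (hmem i)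
  have hS1 : ∀ i, (S i).piece 1 = tets 1 := by
    intro i
    rw [hSp]
    exact solSet_one (hmem i)
  have hbij : Function.Bijective (fun i : Fin 21 =>
      (Quot.mk (fun (F G : {F : TetFence // F.area = 9}) => TetFenceEquiv F.1 G.1)
        ⟨S i, hS9 i⟩)) := by
    constructor
    · intro i j hij
      have heq : Equivalence (fun (F G : {F : TetFence // F.area = 9}) =>
          TetFenceEquiv F.1 G.1) :=
        ⟨fun F => equiv_refl F.1, fun h => equiv_symm h, fun h h' => equiv_trans h h'⟩
      have h : TetFenceEquiv (S i) (S j) :=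
        heq.eqvGen_iff.1 (Quot.eqvGen_exact hij)
      have hp := std_rigid (hS1 i) (hS1 j) h
      refine sol_ne i j fun t x hx => ?_
      have := hp t
      rw [hSp, hSp] at this
      show x ∈ solSet _ _
      rw [this]
      exact hx
    · intro q
      induction q using Quot.ind with
      | mk F =>
        obtain ⟨F, hF⟩ := F
        obtain ⟨G, hG, h1⟩ := normalize F
        have hGa : G.area = 9 := by rw [area_equiv hG, hF]
        rcases (norm_main G h1).2 with h | ⟨-, l, hl, hp⟩
        · omega
        · obtain ⟨n, hn, rfl⟩ := List.mem_iff_getElem.1 hl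
          rw [sol_length] at hn
          refine ⟨⟨n, hn⟩, Quot.sound ?_⟩
          show TetFenceEquiv (S ⟨n, hn⟩) F
          refine equiv_symm (equiv_trans hG ?_)
          refine ⟨fun p => (p.1, p.2), List.mem_cons_self, 0, fun i => ?_⟩
          rw [hSp, hp, List.getD_eq_getElem _ _ (by rw [sol_length]; exact hn)]
          simp
  rw [← Nat.card_congr (Equiv.ofBijective _ hbij), Nat.card_fin]

end TFS

/-- Up to the isometries of the square lattice, there are exactly 21 tetromino
fences whose enclosed area is 9, the maximal value. -/
theorem tetromino_fence_count_21 :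
    (∀ F : TetFence, F.area ≤ 9) ∧
    Nat.card (Quot fun (F G : {F : TetFence // F.area = 9}) =>
      TetFenceEquiv F.1 G.1) = 21 := by
  exact ⟨TFS.area_le, TFS.count21⟩
end

section
/- There exists a pentomino fence whose enclosed area is exactly 128. -/
/-- The twelve free pentominoes F, I, L, N, P, T, U, V, W, X, Y, Z. -/
def pents : Fin 12 → Set Cell :=
  ![{(1,0), (0,1), (1,1), (1,2), (2,2)},
    {(0,0), (0,1), (0,2), (0,3), (0,4)},
    {(0,0), (1,0), (0,1), (0,2), (0,3)},
    {(0,0), (0,1), (1,1), (1,2), (1,3)},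
    {(0,0), (1,0), (0,1), (1,1), (0,2)},
    {(1,0), (1,1), (0,2), (1,2), (2,2)},
    {(0,0), (1,0), (2,0), (0,1), (2,1)},
    {(0,0), (1,0), (2,0), (0,1), (0,2)},
    {(0,0), (1,0), (1,1), (2,1), (2,2)},
    {(1,0), (0,1), (1,1), (2,1), (1,2)},
    {(1,0), (0,1), (1,1), (1,2), (1,3)},
    {(1,0), (2,0), (1,1), (0,2), (1,2)}]

/-- A pentomino fence: twelve pairwise disjoint placements, one of each free
pentomino, whose union is connected, each piece being edge-adjacent to at
least two of the other pieces. -/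
structure PentFence where
  piece : Fin 12 → Set Cell
  placement : ∀ i, IsPlacement (pents i) (piece i)
  disj : Pairwise fun i j => Disjoint (piece i) (piece j)
  conn : SetConnected (⋃ i, piece i)
  adj2 : ∀ i, 2 ≤ Set.ncard {j | j ≠ i ∧ PieceAdj (piece i) (piece j)}

/-- The enclosed area of a pentomino fence. -/
noncomputable def PentFence.area (F : PentFence) : ℕ := encArea (⋃ i, F.piece i)

/-- Lattice symmetry used for each piece. -/
def fenceSym : Fin 12 → Cell → Cell :=
  ![fun p => (p.1, p.2), fun p => (p.2, -p.1), fun p => (-p.1, -p.2), fun p => (-p.2, -p.1), fun p => (p.2, -p.1), fun p => (-p.1, -p.2), fun p => (-p.2, p.1), fun p => (-p.2, p.1), fun p => (-p.1, p.2), fun p => (-p.2, p.1), fun p => (p.1, -p.2), fun p => (-p.1, -p.2)]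

/-- Translation used for each piece. -/
def fenceShift : Fin 12 → Cell :=
  ![(-5, 10), (1, 13), (9, 10), (6, 1), (-2, 13), (-3, 5), (10, 4), (9, 1), (-1, 0), (2, -1), (-5, 9), (8, 13)]

/-- The cells of each placed piece. -/
def fenceCells : Fin 12 → List Cell :=
  ![[(-4, 10), (-5, 11), (-4, 11), (-4, 12), (-3, 12)],
    [(1, 13), (2, 13), (3, 13), (4, 13), (5, 13)],
    [(9, 10), (8, 10), (9, 9), (9, 8), (9, 7)],
    [(6, 1), (5, 1), (5, 0), (4, 0), (3, 0)],
    [(-2, 13), (-2, 12), (-1, 13), (-1, 12), (0, 13)],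
    [(-4, 5), (-4, 4), (-3, 3), (-4, 3), (-5, 3)],
    [(10, 4), (10, 5), (10, 6), (9, 4), (9, 6)],
    [(9, 1), (9, 2), (9, 3), (8, 1), (7, 1)],
    [(-1, 0), (-2, 0), (-2, 1), (-3, 1), (-3, 2)],
    [(2, 0), (1, -1), (1, 0), (1, 1), (0, 0)],
    [(-4, 9), (-5, 8), (-4, 8), (-4, 7), (-4, 6)],
    [(7, 13), (6, 13), (7, 12), (8, 11), (7, 11)]]

/-- All cells of the fence, in breadth-first order (latest first). -/
def fenceWall : List Cell :=
  [(9, 9), (9, 10), (9, 8), (8, 10), (9, 7), (8, 11), (9, 6), (7, 11), (10, 6), (7, 12), (10, 5), (7, 13), (10, 4), (6, 13), (9, 4), (5, 13), (9, 3), (4, 13), (9, 2), (3, 13), (9, 1), (2, 13), (8, 1), (1, 13), (7, 1), (0, 13), (6, 1), (-1, 13), (5, 1), (-2, 13), (-1, 12), (5, 0), (-2, 12), (4, 0), (-3, 12), (3, 0), (-5, 11), (-4, 12), (1, -1), (1, 1), (2, 0), (-4, 11), (1, 0), (-4, 10), (0, 0), (-5, 8), (-4, 9), (-1, 0), (-4,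 8), (-2, 0), (-4, 7), (-2, 1), (-4, 6), (-3, 1), (-4, 5), (-3, 2), (-4, 4), (-3, 3), (-4, 3), (-5, 3)]

/-- Rows of the enclosed region: (y, first x, length). -/
def fenceRows : List (ℤ × ℤ × ℕ) :=
  [(1, -1, 2), (1, 2, 3), (2, -2, 11), (3, -2, 11), (4, -3, 12), (5, -3, 13), (6, -3, 12), (7, -3, 12), (8, -3, 12), (9, -3, 12), (10, -3, 11), (11, -3, 10), (12, 0, 7)]

/-- Neighbours in the ring. -/
def fenceNbr : Fin 12 → Fin 12 × Fin 12 :=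
  ![(10, 4), (4, 11), (11, 6), (7, 9), (0, 1), (8, 10), (2, 7), (6, 3), (9, 5), (3, 8), (5, 0), (1, 2)]

/-- The enclosed region. -/
def fenceInside : List Cell :=
  fenceRows.flatMap fun r => (List.range r.2.2).map fun i => (r.2.1 + (i : ℤ), r.1)

instance fenceAdjDec (p q : Cell) : Decidable (Adj p q) := by
  unfold Adj; infer_instance

/-- The placed pieces. -/
def fencePiece (i : Fin 12) : Set Cell := (fun c => fenceSym i c + fenceShift i) '' pents i

lemma fencePiece_eq (i : Fin 12) : fencePiece i = {c | c ∈ fenceCells i} := by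
  fin_cases i <;>
    simp [fencePiece, fenceSym, fenceShift, pents, fenceCells, Set.image_insert_eq] <;>
    ext c <;> simp

lemma fenceUnion_eq : (⋃ i, fencePiece i) = {c | c ∈ fenceWall} := by
  have h1 : ∀ i, ∀ c ∈ fenceCells i, c ∈ fenceWall := by decide +kernel
  have h2 : ∀ c ∈ fenceWall, ∃ i, c ∈ fenceCells i := by decide +kernel
  ext c
  simp only [fencePiece_eq, Set.mem_iUnion, Set.mem_setOf_eq]
  exact ⟨fun ⟨i, h⟩ => h1 i c h, h2 c⟩

/-- Each cell of the list is the last one or adjacent to a later one. -/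
def chainOk : List Cell → Bool
  | [] => true
  | [_] => true
  | a :: l => decide (∃ b ∈ l, Adj a b) && chainOk l

lemma adj_symm {p q : Cell} (h : Adj p q) : Adj q p := by
  unfold Adj at *; omega

lemma reach_symm {S : Set Cell} {p q : Cell} (h : ReachIn S p q) : ReachIn S q p := by
  unfold ReachIn at *
  induction h with
  | refl => exact .refl
  | tail _ h ih => exact .head ⟨adj_symm h.1, h.2.2, h.2.1⟩ ih

lemma chain_reach (S : Set Cell) (r : Cell) : ∀ l : List Cell, chainOk l = true →
    (∀ c ∈ l, c ∈ S) → l.getLast? = some r → ∀ c ∈ l, ReachIn S c r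
  | [], _, _, _ => by simp
  | [a], _, _, h => by
      simp at h; subst h
      intro c hc; simp at hc; subst hc; exact .refl
  | a :: b :: l, hk, hS, h => by
      simp only [chainOk, Bool.and_eq_true, decide_eq_true_eq] at hk
      have ih := chain_reach S r (b :: l) hk.2
        (fun c hc => hS c (List.mem_cons_of_mem _ hc)) (by simpa using h)
      intro c hc
      rcases List.mem_cons.1 hc with rfl | hc
      · obtain ⟨d, hd, hcd⟩ := hk.1
        exact .head ⟨hcd, hS _ (by simp), hS _ (List.mem_cons_of_mem _ hd)⟩ (ih d hd)
      · exact ih c hc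

lemma fence_conn : SetConnected {c | c ∈ fenceWall} := by
  have hk : chainOk fenceWall = true := by decide +kernel
  obtain ⟨r, hr⟩ : ∃ r, fenceWall.getLast? = some r := ⟨_, rfl⟩
  have h := chain_reach {c | c ∈ fenceWall} r fenceWall hk (fun c hc => hc) hr
  intro p hp q hq
  exact Relation.ReflTransGen.trans (h p hp) (reach_symm (h q hq))

/-- The fence. -/
def theFence : PentFence where
  piece := fencePiece
  placement i := by
    refine ⟨fenceSym i, ?_, fenceShift i, rfl⟩
    fin_cases i <;> simp [fenceSym, symms]
  disj := by
    have h : ∀ i j, i ≠ j → ∀ c ∈ fenceCells i, c ∉ fenceCells j := by decide +kernel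
    intro i j hij
    rw [fencePiece_eq, fencePiece_eq, Set.disjoint_left]
    exact h i j hij
  conn := by
    rw [fenceUnion_eq]; exact fence_conn
  adj2 i := by
    have h : ∀ i, (fenceNbr i).1 ≠ (fenceNbr i).2 ∧ (fenceNbr i).1 ≠ i ∧ (fenceNbr i).2 ≠ i ∧
        (∃ a ∈ fenceCells i, ∃ b ∈ fenceCells (fenceNbr i).1, Adj a b) ∧
        (∃ a ∈ fenceCells i, ∃ b ∈ fenceCells (fenceNbr i).2, Adj a b) := by decide +kernel
    obtain ⟨h0, h1, h2, h3, h4⟩ := h i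
    rw [← Set.ncard_pair h0]
    apply Set.ncard_le_ncard _ (Set.toFinite _)
    intro j hj
    rcases hj with rfl | rfl
    · exact ⟨h1, by rw [fencePiece_eq, fencePiece_eq]; exact h3⟩
    · exact ⟨h2, by rw [fencePiece_eq, fencePiece_eq]; exact h4⟩

lemma fenceInside_closed : ∀ c ∈ fenceInside, c ∉ fenceWall ∧
    ∀ d ∈ [((1 : ℤ), (0 : ℤ)), (-1, 0), (0, 1), (0, -1)],
      c + d ∈ fenceInside ∨ c + d ∈ fenceWall := by decide +kernel

lemma adj_cases {p q : Cell} (h : Adj p q) :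
    ∃ d ∈ [((1 : ℤ), (0 : ℤ)), (-1, 0), (0, 1), (0, -1)], q = p + d := by
  obtain ⟨a, b⟩ := p
  obtain ⟨x, y⟩ := q
  simp only [Adj] at h
  simp only [List.mem_cons, List.not_mem_nil, or_false, exists_eq_or_imp, exists_eq_left,
    Prod.mk_add_mk, Prod.mk.injEq]
  omega

lemma inside_component {c d : Cell} (hc : c ∈ fenceInside)
    (h : ReachIn {c | c ∈ fenceWall}ᶜ c d) : d ∈ fenceInside := by
  unfold ReachIn at h
  induction h with
  | refl => exact hc
  | tail _ h ih =>
    obtain ⟨d, hd, rfl⟩ := adj_cases h.1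
    exact ((fenceInside_closed _ ih).2 d hd).resolve_right h.2.2

/-- The cell `w` is off the ray from `c` in direction `d`. -/
def OffRay (c d w : Cell) : Prop :=
  (w.1 - c.1) * d.2 ≠ (w.2 - c.2) * d.1 ∨ (w.1 - c.1) * d.1 + (w.2 - c.2) * d.2 < 0

instance offRayDec (c d w : Cell) : Decidable (OffRay c d w) := by
  unfold OffRay; infer_instance

lemma ray_box : ∀ x ∈ Finset.Icc ((-5) : ℤ) (10), ∀ y ∈ Finset.Icc ((-1) : ℤ) (13),
    (x, y) ∈ fenceWall ∨ (x, y) ∈ fenceInside ∨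
    ∃ d ∈ [((1 : ℤ), (0 : ℤ)), (-1, 0), (0, 1), (0, -1)], ∀ w ∈ fenceWall, OffRay (x, y) d w := by
  decide +kernel

lemma wall_box : ∀ w ∈ fenceWall, (-5) ≤ w.1 ∧ w.1 ≤ (10) ∧ (-1) ≤ w.2 ∧ w.2 ≤ (13) := by
  decide +kernel

lemma ray_exists (c : Cell) (h1 : c ∉ fenceWall) (h2 : c ∉ fenceInside) :
    ∃ d ∈ [((1 : ℤ), (0 : ℤ)), (-1, 0), (0, 1), (0, -1)], ∀ w ∈ fenceWall, OffRay c d w := by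
  obtain ⟨x, y⟩ := c
  by_cases hx1 : x < (-5)
  · refine ⟨(-1, 0), by simp, fun w hw => Or.inr ?_⟩
    have := wall_box w hw
    simp only; omega
  by_cases hx2 : (10) < x
  · refine ⟨(1, 0), by simp, fun w hw => Or.inr ?_⟩
    have := wall_box w hw
    simp only; omega
  by_cases hy1 : y < (-1)
  · refine ⟨(0, -1), by simp, fun w hw => Or.inr ?_⟩
    have := wall_box w hw
    simp only; omega
  by_cases hy2 : (13) < y
  · refine ⟨(0, 1), by simp, fun w hw => Or.inr ?_⟩
    have := wall_box w hw
    simp only; omega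
  have := ray_box x (by rw [Finset.mem_Icc]; omega) y (by rw [Finset.mem_Icc]; omega)
  exact (this.resolve_left h1).resolve_left h2

lemma ray_infinite (c d : Cell) (hd : d ∈ [((1 : ℤ), (0 : ℤ)), (-1, 0), (0, 1), (0, -1)])
    (h : ∀ w ∈ fenceWall, OffRay c d w) :
    (component {c | c ∈ fenceWall}ᶜ c).Infinite := by
  let g : ℕ → Cell := fun n => (c.1 + n * d.1, c.2 + n * d.2)
  have hfree : ∀ n, g n ∈ {c | c ∈ fenceWall}ᶜ := by
    intro n hn
    have := h _ hn
    simp only [List.mem_cons, List.not_mem_nil, or_false] at hd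
    rcases hd with rfl | rfl | rfl | rfl <;> simp [OffRay, g] at this <;> omega
  have hreach : ∀ n, g n ∈ component {c | c ∈ fenceWall}ᶜ c := by
    intro n
    induction n with
    | zero =>
      have : g 0 = c := by simp [g]
      rw [this]; exact Relation.ReflTransGen.refl
    | succ n ih =>
      refine Relation.ReflTransGen.tail ih ⟨?_, hfree n, hfree (n + 1)⟩
      simp only [List.mem_cons, List.not_mem_nil, or_false] at hd
      rcases hd with rfl | rfl | rfl | rfl <;> simp [Adj, g] <;> omega
  refine Set.infinite_of_injective_forall_mem (f := g) ?_ hreach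
  intro m n hmn
  simp only [List.mem_cons, List.not_mem_nil, or_false] at hd
  rcases hd with rfl | rfl | rfl | rfl <;> simpa [g] using hmn

lemma enclosed_iff (c : Cell) : Enclosed {c | c ∈ fenceWall} c ↔ c ∈ fenceInside := by
  constructor
  · rintro ⟨h1, h2⟩
    by_contra h
    obtain ⟨d, hd, hr⟩ := ray_exists c h1 h
    exact ray_infinite c d hd hr h2
  · intro h
    refine ⟨(fenceInside_closed c h).1, ?_⟩
    exact (List.finite_toSet fenceInside).subset fun d hd => inside_component h hd

/-- There exists a pentomino fence whose enclosed area is exactly 128. -/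
theorem exists_pentomino_fence_area_128 : ∃ F : PentFence, F.area = 128 := by
  refine ⟨theFence, ?_⟩
  have h : {c | Enclosed (⋃ i, theFence.piece i) c} = (fenceInside.toFinset : Set Cell) := by
    ext c
    have : (⋃ i, theFence.piece i) = {c | c ∈ fenceWall} := fenceUnion_eq
    rw [this]
    simp [enclosed_iff]
  have hn : fenceInside.Nodup := by decide +kernel
  have hl : fenceInside.length = 128 := by decide +kernel
  rw [PentFence.area, encArea, h, Set.ncard_coe_finset, List.toFinset_card_of_nodup hn, hl]
end

section
/- Let F be a finite nonempty set of cells whose bounding box has dimensions m × n cells. Then every cell enclosed by F lies strictly inside the bounding box (in none of its boundary rows or columns), and consequently the enclosed area of F is at most (m − 2)(n − 2) minus the number of cells of F that lie strictly inside the bounding box. -/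
/-- An infinite straight ray avoiding `F` cannot start at an enclosed cell. -/
lemma not_enclosed_of_ray (F : Set Cell) (e : Cell) (u v : ℤ) (huv : u.natAbs + v.natAbs = 1)
    (h : ∀ k : ℕ, ((e.1 + k * u, e.2 + k * v) : Cell) ∉ F) : ¬ Enclosed F e := by
  rintro ⟨-, hf⟩
  have hr : ∀ k : ℕ, ReachIn Fᶜ e (e.1 + k * u, e.2 + k * v) := by
    intro k
    induction k with
    | zero =>
      have h0 : ReachIn Fᶜ e e := Relation.ReflTransGen.refl
      simp only [Nat.cast_zero, zero_mul, add_zero]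
      exact h0
    | succ k ih =>
      refine Relation.ReflTransGen.tail ih ⟨?_, h k, h (k + 1)⟩
      have h1 : e.1 + (k : ℤ) * u - (e.1 + ((k + 1 : ℕ) : ℤ) * u) = -u := by push_cast; ring
      have h2 : e.2 + (k : ℤ) * v - (e.2 + ((k + 1 : ℕ) : ℤ) * v) = -v := by push_cast; ring
      simp only [Adj, h1, h2, Int.natAbs_neg, huv]
  refine Set.infinite_of_injective_forall_mem
    (f := fun k : ℕ => ((e.1 + k * u, e.2 + k * v) : Cell)) ?_ hr hf
  intro k l hkl
  simp only [Prod.mk.injEq, add_right_inj, mul_eq_mul_right_iff, Nat.cast_inj] at hkl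
  omega

/-- Let `F` be a finite nonempty set of cells whose bounding box is
`{a,…,b} × {c,…,d}`, of dimensions `m × n` cells. Then every cell enclosed by
`F` lies strictly inside the bounding box, and consequently the enclosed area
of `F` is at most `(m − 2)(n − 2)` minus the number of cells of `F` lying
strictly inside the bounding box. -/
theorem enclosed_in_bounding_box (F : Set Cell) (hfin : F.Finite) (hne : F.Nonempty)
    (a b c d : ℤ) (m n : ℕ)
    (hsub : ∀ p ∈ F, a ≤ p.1 ∧ p.1 ≤ b ∧ c ≤ p.2 ∧ p.2 ≤ d)
    (ha : ∃ p ∈ F, p.1 = a) (hb : ∃ p ∈ F, p.1 = b)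
    (hc : ∃ p ∈ F, p.2 = c) (hd : ∃ p ∈ F, p.2 = d)
    (hm : (m : ℤ) = b - a + 1) (hn : (n : ℤ) = d - c + 1) :
    (∀ e : Cell, Enclosed F e →
        a + 1 ≤ e.1 ∧ e.1 ≤ b - 1 ∧ c + 1 ≤ e.2 ∧ e.2 ≤ d - 1) ∧
    encArea F ≤ (m - 2) * (n - 2) -
      Set.ncard {p ∈ F | a + 1 ≤ p.1 ∧ p.1 ≤ b - 1 ∧ c + 1 ≤ p.2 ∧ p.2 ≤ d - 1} := by
  have key : ∀ e : Cell, Enclosed F e →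
      a + 1 ≤ e.1 ∧ e.1 ≤ b - 1 ∧ c + 1 ≤ e.2 ∧ e.2 ≤ d - 1 := by
    intro e he
    have main : ∀ u v : ℤ, u.natAbs + v.natAbs = 1 →
        (∀ k : ℕ, 1 ≤ k → ((e.1 + k * u, e.2 + k * v) : Cell) ∉ F) → False := by
      intro u v huv h
      refine not_enclosed_of_ray F e u v huv (fun k => ?_) he
      rcases Nat.eq_zero_or_pos k with rfl | hk
      · simpa using he.1
      · exact h k hk
    refine ⟨?_, ?_, ?_, ?_⟩
    · by_contra hlt
      refine main (-1) 0 (by simp) (fun k hk hF => ?_)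
      have := hsub _ hF
      simp only at this
      omega
    · by_contra hlt
      refine main 1 0 (by simp) (fun k hk hF => ?_)
      have := hsub _ hF
      simp only at this
      omega
    · by_contra hlt
      refine main 0 (-1) (by simp) (fun k hk hF => ?_)
      have := hsub _ hF
      simp only at this
      omega
    · by_contra hlt
      refine main 0 1 (by simp) (fun k hk hF => ?_)
      have := hsub _ hF
      simp only at this
      omega
  refine ⟨key, ?_⟩
  set I : Set Cell := {p ∈ F | a + 1 ≤ p.1 ∧ p.1 ≤ b - 1 ∧ c + 1 ≤ p.2 ∧ p.2 ≤ d - 1} with hI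
  let B : Finset Cell := Finset.Icc (a + 1) (b - 1) ×ˢ Finset.Icc (c + 1) (d - 1)
  have hB : B.card = (m - 2) * (n - 2) := by
    simp only [B, Finset.card_product, Int.card_Icc]
    congr 1 <;> omega
  have hEB : {e | Enclosed F e} ⊆ (B : Set Cell) := by
    intro e he
    have := key e he
    simp only [B, Finset.mem_coe, Finset.mem_product, Finset.mem_Icc]
    tauto
  have hIB : I ⊆ (B : Set Cell) := by
    intro e he
    have := he.2
    simp only [B, Finset.mem_coe, Finset.mem_product, Finset.mem_Icc]
    tauto
  have hdis : Disjoint {e | Enclosed F e} I :=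
    Set.disjoint_left.2 fun e he hi => he.1 hi.1
  have hu := Set.ncard_union_eq hdis (B.finite_toSet.subset hEB) (B.finite_toSet.subset hIB)
  have hle := Set.ncard_le_ncard (Set.union_subset hEB hIB) B.finite_toSet
  rw [hu, Set.ncard_coe_finset, hB] at hle
  exact Nat.le_sub_of_add_le hle
end
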